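/- For every ε > 0 there exists x₀ such that for all real x ≥ x₀, for every real A ≥ 0 and every real N with N ≥ exp(3x/log log x), one has |#(S_x ∩ (A, A+N]) − (N/M(x))·#(S_x ∩ (0, M(x)])| ≤ ε·(N/M(x))·#(S_x ∩ (0, M(x)]). In other words, the x-pseudosquares are equidistributed in intervals of length at least exp(3x/log log x): #(S_x ∩ (A, A+N]) = (1+o(1))·(N/M(x))·#(S_x ∩ (0, M(x)]) as x → ∞, uniformly in A and N. -/

import Mathlib

open scoped BigOperators

/-- The finset of primes `p ≤ x`. -/
noncomputable def primesUpTo (x : ℝ) : Finset ℕ := (Finset.Iic ⌊x⌋₊).filter Nat.Prime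

/-- `M(x)`: the product of all primes `p ≤ x`. -/
noncomputable def Mx (x : ℝ) : ℕ := ∏ p ∈ primesUpTo x, p

/-- `π(x)`: the number of primes `p ≤ x`. -/
noncomputable def piX (x : ℝ) : ℕ := (primesUpTo x).card

/-- The Legendre symbol `(a/p)` (junk value `0` if `p` is not prime). -/
noncomputable def legendre (p : ℕ) (a : ℤ) : ℤ :=
  if hp : p.Prime then @legendreSym p ⟨hp⟩ a else 0

/-- An `x`-pseudosquare: a positive integer that is not a perfect square, is `≡ 1 (mod 8)`,
and has Legendre symbol `(n/p) = 1` for every odd prime `p ≤ x`. -/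
def IsPseudosquare (x : ℝ) (n : ℕ) : Prop :=
  0 < n ∧ ¬ IsSquare n ∧ n % 8 = 1 ∧
    ∀ p : ℕ, p.Prime → p ≠ 2 → (p : ℝ) ≤ x → legendre p (n : ℤ) = 1

/-- `#(S_x ∩ (A, A+N])`: the number of `x`-pseudosquares in the interval `(A, A+N]`. -/
noncomputable def pseudosquaresIn (x A N : ℝ) : ℕ :=
  Set.ncard {n : ℕ | IsPseudosquare x n ∧ A < (n : ℝ) ∧ (n : ℝ) ≤ A + N}

section Stepanov

open Polynomial

variable {p : ℕ} [Fact p.Prime]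

/-- The operator `r ↦ f r' + c f' r`, which describes differentiation of `f ^ c * r`. -/
noncomputable def twistedDeriv (f : (ZMod p)[X]) (c : ZMod p) :
    (ZMod p)[X] →ₗ[ZMod p] (ZMod p)[X] :=
  LinearMap.mulLeft (ZMod p) f ∘ₗ derivative +
    c • LinearMap.mulLeft (ZMod p) (derivative f)

/-- The operator `r ↦ f ^ (k - n) (f ^ n r)^{(k)}`. -/
noncomputable def twistedDerivIter (f : (ZMod p)[X]) (n : ℕ) :
    ℕ → (ZMod p)[X] →ₗ[ZMod p] (ZMod p)[X]
  | 0 => LinearMap.id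
  | k + 1 => twistedDeriv f ((n : ZMod p) - k) ∘ₗ twistedDerivIter f n k

lemma twistedDeriv_apply (f r : (ZMod p)[X]) (c : ZMod p) :
    twistedDeriv f c r = f * derivative r + c • (derivative f * r) := by
  simp [twistedDeriv]

lemma twistedDerivIter_succ (f r : (ZMod p)[X]) (n k : ℕ) :
    twistedDerivIter f n (k + 1) r =
      twistedDeriv f ((n : ZMod p) - k) (twistedDerivIter f n k r) := rfl

lemma iterate_derivative_pow_mul (f r Y : (ZMod p)[X]) (hY : derivative Y = 0) (n k : ℕ)
    (hk : k ≤ n) :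
    derivative^[k] (f ^ n * r * Y) = f ^ (n - k) * twistedDerivIter f n k r * Y := by
  induction k with
  | zero => simp [twistedDerivIter]
  | succ k ih =>
    obtain ⟨e, he⟩ : ∃ e, n - k = e + 1 := ⟨n - k - 1, by omega⟩
    have he' : n - (k + 1) = e := by omega
    have hc : ((n : ZMod p) - k) = (e + 1 : ℕ) := by
      rw [← he, Nat.cast_sub (by omega)]
    rw [Function.iterate_succ_apply', ih (by omega), twistedDerivIter_succ, twistedDeriv_apply,
      he, he', hc]
    simp only [derivative_mul, hY, derivative_pow, smul_eq_C_mul]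
    simp only [Nat.add_sub_cancel, map_natCast]
    ring

lemma natDegree_twistedDeriv_lt {f r : (ZMod p)[X]} {c : ZMod p} {b m : ℕ}
    (hf : f.natDegree ≤ m) (hr : r.natDegree < b) :
    (twistedDeriv f c r).natDegree < b + m := by
  rw [twistedDeriv_apply]
  refine lt_of_le_of_lt (natDegree_add_le _ _) (max_lt ?_ ?_)
  · have h1 := natDegree_mul_le (p := f) (q := derivative r)
    have h2 := natDegree_derivative_le r
    omega
  · have h1 := natDegree_mul_le (p := derivative f) (q := r)
    have h2 := natDegree_derivative_le f
    have h3 := natDegree_smul_le c (derivative f * r)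
    omega

lemma natDegree_twistedDerivIter_lt {f r : (ZMod p)[X]} {n b m : ℕ} (k : ℕ)
    (hf : f.natDegree ≤ m) (hr : r.natDegree < b) :
    (twistedDerivIter f n k r).natDegree < b + k * m := by
  induction k with
  | zero => simpa [twistedDerivIter] using hr
  | succ k ih =>
    rw [twistedDerivIter_succ]
    have := natDegree_twistedDeriv_lt (c := (n : ZMod p) - (k : ZMod p)) hf ih
    rwa [add_assoc, ← Nat.succ_mul] at this

lemma eq_zero_of_sq_mul_eq {f r s : (ZMod p)[X]} {a c : ZMod p} (hc : c ≠ 0)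
    (ha : Odd (f.rootMultiplicity a)) (h : r ^ 2 * f = C c * s ^ 2) : r = 0 ∧ s = 0 := by
  have hf : f ≠ 0 := by rintro rfl; simp at ha
  by_cases hr : r = 0
  · subst hr
    refine ⟨rfl, ?_⟩
    have : C c * s ^ 2 = 0 := by rw [← h]; ring
    simpa [hc] using this
  · exfalso
    have hs : s ≠ 0 := by
      rintro rfl
      have : r ^ 2 * f ≠ 0 := mul_ne_zero (pow_ne_zero _ hr) hf
      simp [h] at this
    have h2 := congrArg (rootMultiplicity a) h
    rw [sq, sq, rootMultiplicity_mul (mul_ne_zero (mul_ne_zero hr hr) hf),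
      rootMultiplicity_mul (mul_ne_zero (C_ne_zero.2 hc) (mul_ne_zero hs hs)),
      rootMultiplicity_mul (mul_ne_zero hr hr), rootMultiplicity_mul (mul_ne_zero hs hs),
      rootMultiplicity_C] at h2
    obtain ⟨t, ht⟩ := ha
    omega

lemma X_pow_dvd_pow_sub_C (f : (ZMod p)[X]) : (X : (ZMod p)[X]) ^ p ∣ f ^ p - C (f.eval 0) := by
  have h1 : (X : (ZMod p)[X]) ∣ f - C (f.eval 0) := by
    rw [X_dvd_iff]; simp [coeff_zero_eq_eval_zero]
  have h2 := pow_dvd_pow_of_dvd h1 p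
  rwa [sub_pow_char, ← C_pow, ZMod.pow_card] at h2

lemma coeff_polys_eq_zero {f : (ZMod p)[X]} {a : ZMod p} {B m h : ℕ} (hf0 : f.eval 0 ≠ 0)
    (ha : Odd (f.rootMultiplicity a)) (hm : f.natDegree ≤ m) (hB : 2 * B + m ≤ p)
    (hh : 2 * h + 1 = p) (J : ℕ) : ∀ (r s : ℕ → (ZMod p)[X]),
    (∀ j, (r j).natDegree < B) → (∀ j, (s j).natDegree < B) →
    ∑ j ∈ Finset.range J, (r j + s j * f ^ h) * X ^ (p * j) = 0 →
    ∀ j < J, r j = 0 ∧ s j = 0 := by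
  induction J with
  | zero => intro r s _ _ _ j hj; omega
  | succ J ih =>
    intro r s hr hs hsum
    set U := ∑ j ∈ Finset.range J, r (j + 1) * X ^ (p * j) with hU
    set V := ∑ j ∈ Finset.range J, s (j + 1) * X ^ (p * j) with hV
    have hUV : ∑ j ∈ Finset.range J, (r (j + 1) + s (j + 1) * f ^ h) * X ^ (p * j)
        = U + V * f ^ h := by
      rw [hU, hV, Finset.sum_mul, ← Finset.sum_add_distrib]
      exact Finset.sum_congr rfl fun j _ => by ring
    have hsplit : (r 0 + X ^ p * U) + (s 0 + X ^ p * V) * f ^ h = 0 := by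
      rw [Finset.sum_range_succ'] at hsum
      have : ∑ j ∈ Finset.range J, (r (j + 1) + s (j + 1) * f ^ h) * X ^ (p * (j + 1))
          = X ^ p * (U + V * f ^ h) := by
        rw [← hUV, Finset.mul_sum]
        exact Finset.sum_congr rfl fun j _ => by ring
      rw [this] at hsum
      rw [← hsum]; ring
    have hsq : (r 0 + X ^ p * U) ^ 2 * f = (s 0 + X ^ p * V) ^ 2 * f ^ p := by
      have h1 : r 0 + X ^ p * U = -((s 0 + X ^ p * V) * f ^ h) := eq_neg_of_add_eq_zero_left hsplit
      have h2 : f ^ p = f ^ h * f ^ h * f := (congrArg (f ^ ·) hh.symm).trans (by ring)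
      rw [h1, h2]; ring
    obtain ⟨g, hg⟩ := X_pow_dvd_pow_sub_C f
    have hdvd : (X : (ZMod p)[X]) ^ p ∣ r 0 ^ 2 * f - C (f.eval 0) * s 0 ^ 2 := by
      refine ⟨-(2 * r 0 * U + X ^ p * U ^ 2) * f + (2 * s 0 * V + X ^ p * V ^ 2) * f ^ p
        + s 0 ^ 2 * g, ?_⟩
      have hg' : C (f.eval 0) = f ^ p - X ^ p * g := by rw [← hg]; ring
      rw [hg']
      linear_combination hsq
    have hdeg : (r 0 ^ 2 * f - C (f.eval 0) * s 0 ^ 2).natDegree < p := by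
      have hr0 := hr 0
      have hs0 := hs 0
      refine lt_of_le_of_lt (natDegree_sub_le _ _) (max_lt ?_ ?_)
      · have h1 := natDegree_mul_le (p := r 0 ^ 2) (q := f)
        have h2 := natDegree_pow_le (p := r 0) (n := 2)
        omega
      · have h1 := natDegree_C_mul_le (f.eval 0) (s 0 ^ 2)
        have h2 := natDegree_pow_le (p := s 0) (n := 2)
        omega
    have hzero : r 0 ^ 2 * f - C (f.eval 0) * s 0 ^ 2 = 0 := by
      by_contra hne
      have := natDegree_le_of_dvd hdvd hne
      rw [natDegree_X_pow] at this
      omega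
    obtain ⟨hr0, hs0⟩ := eq_zero_of_sq_mul_eq hf0 ha (sub_eq_zero.1 hzero)
    have hrest : U + V * f ^ h = 0 := by
      have : (X : (ZMod p)[X]) ^ p * (U + V * f ^ h) = 0 := by
        rw [← hsplit, hr0, hs0]; ring
      exact (mul_eq_zero.1 this).resolve_left (pow_ne_zero _ X_ne_zero)
    have := ih (fun j => r (j + 1)) (fun j => s (j + 1)) (fun j => hr _) (fun j => hs _)
      (by rw [hUV, hrest])
    rintro (_ | j) hj
    · exact ⟨hr0, hs0⟩
    · exact this j (by omega)

lemma exists_polys_twistedDerivIter_eq_zero {f : (ZMod p)[X]} {m l B J h : ℕ} (ε : ZMod p)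
    (hm : f.natDegree ≤ m) (hB : 0 < B) (hcount : l * (B + l * m + J) < J * (2 * B)) :
    ∃ r s : ℕ → (ZMod p)[X], (∀ j, (r j).natDegree < B) ∧ (∀ j, (s j).natDegree < B) ∧
      (∃ j < J, r j ≠ 0 ∨ s j ≠ 0) ∧
      ∀ k < l, ∑ j ∈ Finset.range J, (twistedDerivIter f l k (r j) +
        ε • twistedDerivIter f (l + h) k (s j)) * X ^ j = 0 := by
  classical
  let toPoly : (Fin B → ZMod p) →ₗ[ZMod p] (ZMod p)[X] :=
    (degreeLT (ZMod p) B).subtype ∘ₗ (degreeLTEquiv (ZMod p) B).symm.toLinearMap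
  have hdeg : ∀ v, (toPoly v).natDegree < B := fun v => by
    have h1 : (toPoly v).degree < B := mem_degreeLT.1 ((degreeLTEquiv (ZMod p) B).symm v).2
    by_cases h0 : toPoly v = 0
    · rw [h0]; simpa using hB
    · exact (natDegree_lt_iff_degree_lt h0).2 h1
  have hinj : ∀ v, toPoly v = 0 → v = 0 := fun v hv => by
    have : (degreeLTEquiv (ZMod p) B).symm v = 0 := Subtype.ext hv
    simpa using this
  let G : Fin l → (Fin J → Bool → Fin B → ZMod p) →ₗ[ZMod p] (ZMod p)[X] := fun k =>
    ∑ j : Fin J, LinearMap.mulRight (ZMod p) (X ^ (j : ℕ)) ∘ₗ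
      (twistedDerivIter f l k ∘ₗ toPoly ∘ₗ LinearMap.proj true +
        ε • (twistedDerivIter f (l + h) k ∘ₗ toPoly ∘ₗ LinearMap.proj false)) ∘ₗ LinearMap.proj j
  let T : (Fin J → Bool → Fin B → ZMod p) →ₗ[ZMod p] (Fin l → Fin (B + l * m + J) → ZMod p) :=
    LinearMap.pi fun k => LinearMap.pi fun i => lcoeff (ZMod p) i ∘ₗ G k
  have hker : LinearMap.ker T ≠ ⊥ := by
    apply LinearMap.ker_ne_bot_of_finrank_lt
    simpa [Module.finrank_pi_fintype] using hcount
  obtain ⟨v, hv, hv0⟩ := Submodule.exists_mem_ne_zero_of_ne_bot hker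
  refine ⟨fun j => if hj : j < J then toPoly (v ⟨j, hj⟩ true) else 0,
    fun j => if hj : j < J then toPoly (v ⟨j, hj⟩ false) else 0, ?_, ?_, ?_, ?_⟩
  · intro j; dsimp only; split_ifs
    · exact hdeg _
    · simpa using hB
  · intro j; dsimp only; split_ifs
    · exact hdeg _
    · simpa using hB
  · by_contra! hcon
    apply hv0
    ext j b i
    have := hcon j j.2
    simp only [j.2, dif_pos] at this
    cases b
    · rw [hinj _ this.2]; rfl
    · rw [hinj _ this.1]; rfl
  · intro k hk
    have hG : ∑ j ∈ Finset.range J,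
        (twistedDerivIter f l k (if hj : j < J then toPoly (v ⟨j, hj⟩ true) else 0) +
        ε • twistedDerivIter f (l + h) k (if hj : j < J then toPoly (v ⟨j, hj⟩ false) else 0))
        * X ^ j = G ⟨k, hk⟩ v := by
      rw [Finset.sum_range]
      simp [G]
    rw [hG]
    ext i
    by_cases hi : i < B + l * m + J
    · have := congrFun (congrFun (LinearMap.mem_ker.1 hv) ⟨k, hk⟩) ⟨i, hi⟩
      simpa [T] using this
    · rw [coeff_zero]
      apply coeff_eq_zero_of_natDegree_lt
      refine lt_of_lt_of_le ?_ (not_lt.1 hi)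
      rw [← hG]
      have hpos : 0 < B + l * m + J := by omega
      apply Nat.lt_of_le_pred hpos
      apply natDegree_sum_le_of_forall_le
      intro j hj
      rw [Finset.mem_range] at hj
      have hkm : k * m ≤ l * m := Nat.mul_le_mul_right m hk.le
      have h1 := natDegree_twistedDerivIter_lt (n := l) k hm (hdeg (v ⟨j, hj⟩ true))
      have h2 := natDegree_twistedDerivIter_lt (n := l + h) k hm (hdeg (v ⟨j, hj⟩ false))
      have h3 := natDegree_smul_le ε (twistedDerivIter f (l + h) k (toPoly (v ⟨j, hj⟩ false)))
      simp only [hj, dif_pos]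
      have h4 := natDegree_add_le (twistedDerivIter f l k (toPoly (v ⟨j, hj⟩ true)))
        (ε • twistedDerivIter f (l + h) k (toPoly (v ⟨j, hj⟩ false)))
      refine natDegree_mul_le.trans ?_
      rw [natDegree_X_pow]
      have := h4.trans (max_le (Nat.le_pred_of_lt (h1.trans_le (by omega : _ ≤ B + l * m)))
        (Nat.le_pred_of_lt (lt_of_le_of_lt h3 (h2.trans_le (by omega : _ ≤ B + l * m)))))
      simp only [Nat.pred_eq_sub_one] at this ⊢
      omega

lemma card_mul_le_of_twisted {f : (ZMod p)[X]} {a : ZMod p} {B m h l J : ℕ} (ε : ZMod p)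
    (hf0 : f.eval 0 ≠ 0)
    (ha : Odd (f.rootMultiplicity a)) (hm : f.natDegree ≤ m) (hBpos : 0 < B)
    (hB : 2 * B + m ≤ p) (hh : 2 * h + 1 = p) (hl : 0 < l) (hlp : l ≤ p)
    (hcount : l * (B + l * m + J) < J * (2 * B)) :
    (Finset.univ.filter fun x : ZMod p => (f.eval x) ^ h = ε).card * l ≤
      (l + h) * m + B + J * p := by
  classical
  obtain ⟨r, s, hr, hs, ⟨j₀, hj₀, hne⟩, hD⟩ :=
    exists_polys_twistedDerivIter_eq_zero (h := h) ε hm hBpos hcount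
  set R : (ZMod p)[X] := ∑ j ∈ Finset.range J,
    (f ^ l * r j * X ^ (p * j) + f ^ (l + h) * s j * X ^ (p * j)) with hR
  have hRfac : R = f ^ l * ∑ j ∈ Finset.range J, (r j + s j * f ^ h) * X ^ (p * j) := by
    rw [hR, Finset.mul_sum]
    exact Finset.sum_congr rfl fun j _ => by ring
  have hR0 : R ≠ 0 := by
    intro h0
    have hf : f ≠ 0 := by rintro rfl; simp at hf0
    rw [hRfac] at h0
    have h1 := (mul_eq_zero.1 h0).resolve_left (pow_ne_zero _ hf)
    have := coeff_polys_eq_zero hf0 ha hm hB hh J r s hr hs h1 j₀ hj₀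
    tauto
  have hXder : ∀ j, derivative ((X : (ZMod p)[X]) ^ (p * j)) = 0 := fun j => by
    rw [derivative_X_pow]; simp
  have hder : ∀ k ≤ l, derivative^[k] R = ∑ j ∈ Finset.range J,
      (f ^ (l - k) * twistedDerivIter f l k (r j) * X ^ (p * j) +
        f ^ (l + h - k) * twistedDerivIter f (l + h) k (s j) * X ^ (p * j)) := by
    intro k hk
    rw [hR, iterate_derivative_sum]
    refine Finset.sum_congr rfl fun j _ => ?_
    rw [iterate_map_add, iterate_derivative_pow_mul _ _ _ (hXder j) _ _ hk,
      iterate_derivative_pow_mul _ _ _ (hXder j) _ _ (by omega)]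
  have hroot : ∀ x : ZMod p, (f.eval x) ^ h = ε → l ≤ R.rootMultiplicity x := by
    intro x hx
    have : l - 1 < R.rootMultiplicity x := by
      apply lt_rootMultiplicity_of_isRoot_iterate_derivative_of_mem_nonZeroDivisors' hR0
      · intro k hk
        rw [hder k (by omega), IsRoot.def]
        have hz := congrArg (eval x) (hD k (by omega))
        rw [eval_finsetSum] at hz ⊢
        rw [eval_zero] at hz
        rw [← mul_zero (eval x f ^ (l - k)), ← hz, Finset.mul_sum]
        refine Finset.sum_congr rfl fun j _ => ?_
        have he : l + h - k = (l - k) + h := by omega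
        simp only [eval_add, eval_mul, eval_pow, eval_X, eval_smul, smul_eq_mul, he, pow_add,
          pow_mul, ZMod.pow_card, hx]
        ring
      · intro k hk hk0
        rw [mem_nonZeroDivisors_iff_ne_zero, Ne, ZMod.natCast_eq_zero_iff]
        intro hdvd
        have := Nat.le_of_dvd (Nat.pos_of_ne_zero hk0) hdvd
        omega
    omega
  have hcard : (Finset.univ.filter fun x : ZMod p => (f.eval x) ^ h = ε).card * l ≤
      R.natDegree := by
    calc _ = ∑ x ∈ Finset.univ.filter fun x : ZMod p => (f.eval x) ^ h = ε, l := by simp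
      _ ≤ ∑ x ∈ Finset.univ.filter fun x : ZMod p => (f.eval x) ^ h = ε,
          R.roots.count x := by
        refine Finset.sum_le_sum fun x hx => ?_
        rw [count_roots]
        exact hroot x (Finset.mem_filter.1 hx).2
      _ ≤ ∑ x : ZMod p, R.roots.count x :=
        Finset.sum_le_sum_of_subset (Finset.filter_subset _ _)
      _ = R.roots.card := Multiset.sum_count_eq_card (fun _ _ => Finset.mem_univ _)
      _ ≤ R.natDegree := card_roots' R
  refine hcard.trans ?_
  rw [hR]
  apply natDegree_sum_le_of_forall_le
  intro j hj
  rw [Finset.mem_range] at hj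
  have hjp : p * j ≤ J * p := by rw [mul_comm]; exact Nat.mul_le_mul_right _ hj.le
  have hpow : ∀ n, (f ^ n).natDegree ≤ n * m := fun n =>
    natDegree_pow_le.trans (Nat.mul_le_mul_left n hm)
  have hlm : l * m ≤ (l + h) * m := Nat.mul_le_mul_right _ (by omega)
  have hX : ((X : (ZMod p)[X]) ^ (p * j)).natDegree ≤ p * j := natDegree_X_pow_le _
  refine (natDegree_add_le _ _).trans (max_le ?_ ?_)
  · have h1 := natDegree_mul_le (p := f ^ l * r j) (q := X ^ (p * j))
    have h2 := natDegree_mul_le (p := f ^ l) (q := r j)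
    have h3 := hpow l
    have h4 := hr j
    omega
  · have h1 := natDegree_mul_le (p := f ^ (l + h) * s j) (q := X ^ (p * j))
    have h2 := natDegree_mul_le (p := f ^ (l + h)) (q := s j)
    have h3 := hpow (l + h)
    have h4 := hs j
    omega

lemma two_mul_card_pow_eq_le {f : (ZMod p)[X]} {a : ZMod p} {m h : ℕ} (ε : ZMod p)
    (hf0 : f.eval 0 ≠ 0) (ha : Odd (f.rootMultiplicity a)) (hm : f.natDegree ≤ m)
    (hm1 : 1 ≤ m) (hh : 2 * h + 1 = p) (hp : 729 * m ^ 2 < p) :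
    2 * ((Finset.univ.filter fun x : ZMod p => (f.eval x) ^ h = ε).card : ℝ) ≤
      p + 26 * m * √p := by
  set Z := (Finset.univ.filter fun x : ZMod p => (f.eval x) ^ h = ε).card
  set q := Nat.sqrt p with hq
  have hq1 : q * q ≤ p := Nat.sqrt_le p
  have hq2 : p < (q + 1) * (q + 1) := Nat.lt_succ_sqrt p
  have hq27 : 27 ≤ q := by
    by_contra hlt
    have : q + 1 ≤ 27 := by omega
    nlinarith
  set u := q / 2 with hu
  set B := (p - m) / 2 with hB
  have hmp : 729 * m ≤ p := by nlinarith
  have hB1 : 2 * B + m ≤ p := by omega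
  have hB2 : p ≤ 2 * B + m + 1 := by omega
  have huq : 2 * u ≤ q := by omega
  have huq' : q ≤ 2 * u + 1 := by omega
  have hup : 4 * u * u ≤ p := by nlinarith
  have hu0 : 13 ≤ u := by omega
  have hqp : 27 * q ≤ p := by nlinarith
  have hcount : 2 * u * (B + 2 * u * m + (u + 5 * m)) < (u + 5 * m) * (2 * B) := by
    have h1 : 4 * u * u * m ≤ p * m := Nat.mul_le_mul_right m hup
    have h2 : u * u ≤ u * u * m := Nat.le_mul_of_pos_right _ hm1
    have h3 : (54 * u) * m ≤ p * m := Nat.mul_le_mul_right m (by omega)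
    have h4 : p * m ≤ (2 * B + m + 1) * m := Nat.mul_le_mul_right m hB2
    have h5 : (729 * m) * m ≤ p * m := Nat.mul_le_mul_right m hmp
    have h6 : 729 * m ≤ p * m := Nat.mul_le_mul_right m (by omega)
    linarith
  have hmain := card_mul_le_of_twisted (l := 2 * u) (J := u + 5 * m) (B := B) ε hf0 ha hm
    (by omega) hB1 hh (by omega) (by omega) hcount
  have hmain' : Z * (2 * u) ≤ u * p + 2 * u * m + 6 * m * p := by
    have h1 : (2 * u + h) * m + B + (u + 5 * m) * p ≤ u * p + 2 * u * m + 6 * m * p := by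
      have h1 : (2 * h) * m ≤ p * m := Nat.mul_le_mul_right m (by omega)
      have h2 : p ≤ p * m := Nat.le_mul_of_pos_right _ hm1
      linarith
    exact hmain.trans h1
  have hreal : (Z : ℝ) * (2 * u) ≤ u * p + 2 * u * m + 6 * m * p := by exact_mod_cast hmain'
  have hsq : √(p : ℝ) * √(p : ℝ) = p := Real.mul_self_sqrt (Nat.cast_nonneg p)
  have hsqu : √(p : ℝ) ≤ 4 * u := by
    rw [Real.sqrt_le_left (by positivity)]
    have : p ≤ (4 * u) ^ 2 := by
      have : (q + 1) * (q + 1) ≤ (4 * u) * (4 * u) := Nat.mul_le_mul (by omega) (by omega)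
      rw [sq]; omega
    exact_mod_cast this
  have hs1 : 1 ≤ √(p : ℝ) := Real.one_le_sqrt.2 (by exact_mod_cast (Fact.out : p.Prime).one_le)
  have hu' : (0 : ℝ) < u := by exact_mod_cast (by omega : 0 < u)
  have hm' : (0 : ℝ) < m := by exact_mod_cast hm1
  have hkey : (u : ℝ) * (2 * Z) ≤ u * (p + 26 * m * √p) := by
    have h1 : (6 : ℝ) * m * p ≤ u * (24 * m * √p) := calc
      (6 : ℝ) * m * p = 6 * m * √p * √p := by rw [mul_assoc (6 * (m : ℝ)), hsq]
      _ ≤ 6 * m * √p * (4 * u) := mul_le_mul_of_nonneg_left hsqu (by positivity)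
      _ = u * (24 * m * √p) := by ring
    have h2 : (2 : ℝ) * u * m * 1 ≤ 2 * u * m * √p :=
      mul_le_mul_of_nonneg_left hs1 (by positivity)
    linarith
  exact le_of_mul_le_mul_left hkey hu'

lemma abs_sum_quadraticChar_le_of_eval_zero_ne {f : (ZMod p)[X]} {a : ZMod p} {m : ℕ} (hp2 : p ≠ 2)
    (hf0 : f.eval 0 ≠ 0) (ha : Odd (f.rootMultiplicity a)) (hm : f.natDegree ≤ m)
    (hp : 729 * m ^ 2 < p) :
    |∑ x : ZMod p, (quadraticChar (ZMod p) (f.eval x) : ℝ)| ≤ 27 * m * √p := by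
  classical
  have hf : f ≠ 0 := by rintro rfl; simp at hf0
  have hm1 : 1 ≤ m := by
    have h1 : 0 < f.rootMultiplicity a := ha.pos
    have h2 : f.rootMultiplicity a ≤ f.natDegree := by
      rw [← count_roots]
      exact (Multiset.count_le_card _ _).trans (card_roots' f)
    omega
  have hchar : ringChar (ZMod p) ≠ 2 := by rwa [ZMod.ringChar_zmod_n]
  obtain ⟨h, hh'⟩ := (Fact.out : p.Prime).odd_of_ne_two hp2
  have hh : 2 * h + 1 = p := hh'.symm
  have hcard : Fintype.card (ZMod p) / 2 = h := by rw [ZMod.card]; omega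
  have hne : (1 : ZMod p) ≠ -1 := (Ring.neg_one_ne_one_of_char_ne_two hchar).symm
  have hval : ∀ v : ZMod p, (quadraticChar (ZMod p) v : ℝ) =
      (if v ^ h = 1 then 1 else 0) - (if v ^ h = -1 then 1 else 0) := by
    intro v
    have h1 : ((quadraticChar (ZMod p) v : ℤ) : ZMod p) = v ^ h := by
      rw [quadraticChar_eq_pow_of_char_ne_two' hchar, hcard]
    by_cases hv : v = 0
    · have hh0 : h ≠ 0 := by rintro rfl; have := (Fact.out : p.Prime).two_le; omega
      simp [hv, hh0]
    · rcases quadraticChar_dichotomy hv with hd | hd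
      · rw [← h1, hd]; simp [hne]
      · rw [← h1, hd]; simp [hne.symm]
  set Zp := (Finset.univ.filter fun x : ZMod p => (f.eval x) ^ h = 1).card with hZp
  set Zm := (Finset.univ.filter fun x : ZMod p => (f.eval x) ^ h = -1).card with hZm
  have hsum : ∑ x : ZMod p, (quadraticChar (ZMod p) (f.eval x) : ℝ) = Zp - Zm := by
    simp only [hval, Finset.sum_sub_distrib, Finset.sum_boole, hZp, hZm]
  have htot : p ≤ Zp + Zm + m := by
    have hroots : (Finset.univ.filter fun x : ZMod p => f.eval x = 0).card ≤ m := by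
      have hsub : (Finset.univ.filter fun x : ZMod p => f.eval x = 0) ⊆ f.roots.toFinset := by
        intro x hx
        simpa [hf] using hx
      exact (Finset.card_le_card hsub).trans ((Multiset.toFinset_card_le _).trans
        ((card_roots' f).trans hm))
    have hcover : (Finset.univ : Finset (ZMod p)) ⊆
        ((Finset.univ.filter fun x : ZMod p => (f.eval x) ^ h = 1) ∪
        (Finset.univ.filter fun x : ZMod p => (f.eval x) ^ h = -1)) ∪
        (Finset.univ.filter fun x : ZMod p => f.eval x = 0) := by
      intro x _
      simp only [Finset.mem_union, Finset.mem_filter, Finset.mem_univ, true_and]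
      by_cases hv : f.eval x = 0
      · exact Or.inr hv
      · left
        have h1 := quadraticChar_eq_pow_of_char_ne_two' hchar (f.eval x)
        rw [hcard] at h1
        rcases quadraticChar_dichotomy hv with hd | hd <;> rw [hd] at h1 <;> simp [← h1]
    have h1 := Finset.card_le_card hcover
    rw [Finset.card_univ, ZMod.card] at h1
    have h2 := Finset.card_union_le ((Finset.univ.filter fun x : ZMod p => (f.eval x) ^ h = 1) ∪
        (Finset.univ.filter fun x : ZMod p => (f.eval x) ^ h = -1))
        (Finset.univ.filter fun x : ZMod p => f.eval x = 0)
    have h3 := Finset.card_union_le (Finset.univ.filter fun x : ZMod p => (f.eval x) ^ h = 1)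
        (Finset.univ.filter fun x : ZMod p => (f.eval x) ^ h = -1)
    omega
  have hb1 := two_mul_card_pow_eq_le 1 hf0 ha hm hm1 hh hp
  have hb2 := two_mul_card_pow_eq_le (-1) hf0 ha hm hm1 hh hp
  rw [← hZp] at hb1
  rw [← hZm] at hb2
  have htot' : (p : ℝ) ≤ Zp + Zm + m := by exact_mod_cast htot
  have hs1 : 1 ≤ √(p : ℝ) := Real.one_le_sqrt.2 (by exact_mod_cast (Fact.out : p.Prime).one_le)
  have hms : (m : ℝ) ≤ m * √p := le_mul_of_one_le_right (Nat.cast_nonneg m) hs1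
  rw [hsum, abs_le]
  constructor <;> linarith

/-- **Weil's bound** for quadratic character sums over a prime field, with a non-optimal
constant. -/
lemma abs_sum_quadraticChar_le {f : (ZMod p)[X]} {a : ZMod p} {m : ℕ} (hp2 : p ≠ 2)
    (ha : Odd (f.rootMultiplicity a)) (hm : f.natDegree ≤ m) :
    |∑ x : ZMod p, (quadraticChar (ZMod p) (f.eval x) : ℝ)| ≤ 27 * m * √p := by
  classical
  have hf : f ≠ 0 := by rintro rfl; simp at ha
  have hsq : √(p : ℝ) * √(p : ℝ) = p := Real.mul_self_sqrt (Nat.cast_nonneg p)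
  have hs0 : 0 ≤ √(p : ℝ) := Real.sqrt_nonneg _
  by_cases hp : 729 * m ^ 2 < p
  · obtain ⟨c, hc⟩ : ∃ c, f.eval c ≠ 0 := by
      by_contra! hcon
      apply hf
      apply eq_zero_of_natDegree_lt_card_of_eval_eq_zero' f Finset.univ (fun x _ => hcon x)
      rw [Finset.card_univ, ZMod.card]
      nlinarith
    have h1 : (f.comp (X + C c)).eval 0 ≠ 0 := by simpa using hc
    have h2 : (f.comp (X + C c)).rootMultiplicity (a - c) = f.rootMultiplicity a := by
      rw [rootMultiplicity_eq_rootMultiplicity, rootMultiplicity_eq_rootMultiplicity (t := a),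
        comp_assoc]
      congr 2
      simp [add_assoc]
    have h3 : (f.comp (X + C c)).natDegree ≤ m := by
      rwa [natDegree_comp, natDegree_X_add_C, mul_one]
    have := abs_sum_quadraticChar_le_of_eval_zero_ne hp2 h1 (h2 ▸ ha) h3 hp
    rwa [← Equiv.sum_comp (Equiv.addRight c) fun x => (quadraticChar (ZMod p) (f.eval x) : ℝ),
      Finset.sum_congr rfl fun x _ => by
        rw [show f.eval (Equiv.addRight c x) = (f.comp (X + C c)).eval x by simp]]
  · have hle : (p : ℝ) ≤ 729 * m ^ 2 := by exact_mod_cast not_lt.1 hp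
    have h1 : √(p : ℝ) ≤ 27 * m := by
      rw [Real.sqrt_le_left (by positivity)]; nlinarith
    calc |∑ x : ZMod p, (quadraticChar (ZMod p) (f.eval x) : ℝ)|
        ≤ ∑ x : ZMod p, |(quadraticChar (ZMod p) (f.eval x) : ℝ)| := Finset.abs_sum_le_sum_abs _ _
      _ ≤ ∑ x : ZMod p, 1 := by
        refine Finset.sum_le_sum fun x _ => ?_
        by_cases hv : f.eval x = 0
        · simp [hv]
        · rcases quadraticChar_dichotomy hv with hd | hd <;> simp [hd]
      _ = √(p : ℝ) * √(p : ℝ) := by simp [hsq, ZMod.card]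
      _ ≤ 27 * m * √p := mul_le_mul_of_nonneg_right h1 hs0

end Stepanov

section Box

open Finset

lemma expect_pow_two_pow_le {ι : Type*} [Fintype ι] [Nonempty ι] (z : ι → ℝ) (k : ℕ) :
    (𝔼 i, z i) ^ 2 ^ k ≤ 𝔼 i, z i ^ 2 ^ k := by
  rcases k.eq_zero_or_pos with rfl | hk
  · simp
  have hc : (0 : ℝ) < Fintype.card ι := by exact_mod_cast Fintype.card_pos
  have h2 := Real.pow_arith_mean_le_arith_mean_pow_of_even (univ : Finset ι)
    (fun _ => (Fintype.card ι : ℝ)⁻¹) z (fun _ _ => by positivity)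
    (by simp [hc.ne']) (n := 2 ^ k) (Nat.even_pow.2 ⟨even_two, hk.ne'⟩)
  simp only [← mul_sum] at h2
  simpa only [Fintype.expect_eq_sum_div_card, div_eq_inv_mul] using h2

/-- The vertex of the combinatorial cube spanned by `a` and `b` selected by `w`. -/
def cubeVertex {k : ℕ} {X : Type*} (a b : Fin k → X) (w : Fin k → Bool) : Fin k → X :=
  fun i => if w i then b i else a i

lemma expect_fin_succ {k : ℕ} {X : Type*} [Fintype X] (g : (Fin (k + 1) → X) → ℝ) :
    𝔼 h, g h = 𝔼 y, 𝔼 h', g (Fin.cons y h') := by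
  rw [← Fintype.expect_equiv (Fin.consEquiv fun _ => X) (fun q => g (Fin.cons q.1 q.2)) g
    (fun _ => rfl), ← univ_product_univ, expect_product]

lemma prod_cubeVertex_succ {k : ℕ} {X : Type*} (B : (Fin (k + 1) → X) → ℝ) (y₀ y₁ : X)
    (a b : Fin k → X) :
    ∏ w, B (cubeVertex (Fin.cons y₀ a) (Fin.cons y₁ b) w) =
      ∏ w, B (Fin.cons y₀ (cubeVertex a b w)) * B (Fin.cons y₁ (cubeVertex a b w)) := by
  rw [← Fintype.prod_equiv (Fin.consEquiv fun _ => Bool)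
    (fun q => B (cubeVertex (Fin.cons y₀ a) (Fin.cons y₁ b) (Fin.cons q.1 q.2))) _ (fun _ => rfl),
    Fintype.prod_prod_type, Fintype.prod_bool, ← prod_mul_distrib]
  refine prod_congr rfl fun w _ => ?_
  rw [mul_comm]
  congr 2 <;>
  · ext i
    refine Fin.cases ?_ (fun i => ?_) i <;> simp [cubeVertex]

/-- The Gowers–Cauchy–Schwarz inequality for box norms. -/
lemma expect_prod_mul_pow_le {X : Type*} [Fintype X] [Nonempty X] (k : ℕ) :
    ∀ (A : Fin k → (Fin k → X) → ℝ) (B : (Fin k → X) → ℝ),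
    (∀ j h, |A j h| ≤ 1) → (∀ j h x, A j (Function.update h j x) = A j h) →
    (𝔼 h, (∏ j, A j h) * B h) ^ 2 ^ k ≤ 𝔼 a, 𝔼 b, ∏ w, B (cubeVertex a b w) := by
  induction k with
  | zero =>
    intro A B _ _
    have : ∀ h : Fin 0 → X, h = finZeroElim := fun h => Subsingleton.elim _ _
    simp only [this, Fintype.expect_const]
    simp
  | succ k ih =>
    intro A B hA hind
    set G : X → (Fin k → X) → ℝ := fun y h =>
      (∏ j : Fin k, A j.succ (Fin.cons y h)) * B (Fin.cons y h) with hG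
    set Z : X → X → ℝ := fun y₀ y₁ => 𝔼 h : Fin k → X,
      (∏ j : Fin k, A j.succ (Fin.cons y₀ h) * A j.succ (Fin.cons y₁ h)) *
        (B (Fin.cons y₀ h) * B (Fin.cons y₁ h)) with hZ
    obtain ⟨x₀⟩ := ‹Nonempty X›
    have hA0 : ∀ y h, A 0 (Fin.cons y h) = A 0 (Fin.cons x₀ h) := fun y h => by
      rw [← hind 0 (Fin.cons y h) x₀, Fin.update_cons_zero]
    have h1 : 𝔼 h, (∏ j, A j h) * B h = 𝔼 h : Fin k → X, A 0 (Fin.cons x₀ h) * 𝔼 y, G y h := by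
      rw [expect_fin_succ, expect_comm]
      refine expect_congr rfl fun h _ => ?_
      rw [mul_expect]
      refine expect_congr rfl fun y _ => ?_
      rw [Fin.prod_univ_succ, hA0, mul_assoc]
    have h2 : (𝔼 h, (∏ j, A j h) * B h) ^ 2 ≤ 𝔼 y₀, 𝔼 y₁, Z y₀ y₁ := by
      rw [h1]
      refine (expect_pow_two_pow_le _ 1).trans ?_
      calc 𝔼 h : Fin k → X, (A 0 (Fin.cons x₀ h) * 𝔼 y, G y h) ^ 2 ^ 1
          ≤ 𝔼 h : Fin k → X, (𝔼 y, G y h) * 𝔼 y, G y h := by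
            refine expect_le_expect fun h _ => ?_
            rw [pow_one, mul_pow, sq (𝔼 y, G y h)]
            exact mul_le_of_le_one_left (mul_self_nonneg _)
              ((sq_le_one_iff_abs_le_one _).2 (hA _ _))
        _ = 𝔼 y₀, 𝔼 y₁, Z y₀ y₁ := by
            simp only [expect_mul_expect, hZ]
            rw [expect_comm]
            refine expect_congr rfl fun y₀ _ => ?_
            rw [expect_comm]
            refine expect_congr rfl fun y₁ _ => expect_congr rfl fun h _ => ?_
            simp only [hG, prod_mul_distrib]
            ring
    have h3 : ∀ y₀ y₁, Z y₀ y₁ ^ 2 ^ k ≤ 𝔼 a, 𝔼 b,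
        ∏ w, B (cubeVertex (Fin.cons y₀ a) (Fin.cons y₁ b) w) := by
      intro y₀ y₁
      simp only [prod_cubeVertex_succ]
      refine ih (fun j h => A j.succ (Fin.cons y₀ h) * A j.succ (Fin.cons y₁ h))
        (fun h => B (Fin.cons y₀ h) * B (Fin.cons y₁ h)) (fun j h => ?_) (fun j h x => ?_)
      · rw [abs_mul]
        exact mul_le_one₀ (hA _ _) (abs_nonneg _) (hA _ _)
      · simp only [Fin.cons_update, hind]
    calc (𝔼 h, (∏ j, A j h) * B h) ^ 2 ^ (k + 1)
        = ((𝔼 h, (∏ j, A j h) * B h) ^ 2) ^ 2 ^ k := by rw [← pow_mul, pow_succ']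
      _ ≤ (𝔼 y₀, 𝔼 y₁, Z y₀ y₁) ^ 2 ^ k := by
          exact pow_le_pow_left₀ (sq_nonneg _) h2 _
      _ ≤ 𝔼 y₀, (𝔼 y₁, Z y₀ y₁) ^ 2 ^ k := expect_pow_two_pow_le _ _
      _ ≤ 𝔼 y₀, 𝔼 y₁, Z y₀ y₁ ^ 2 ^ k :=
          expect_le_expect fun y₀ _ => expect_pow_two_pow_le _ _
      _ ≤ 𝔼 y₀, 𝔼 y₁, 𝔼 a, 𝔼 b, ∏ w, B (cubeVertex (Fin.cons y₀ a) (Fin.cons y₁ b) w) :=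
          expect_le_expect fun y₀ _ => expect_le_expect fun y₁ _ => h3 y₀ y₁
      _ = 𝔼 a, 𝔼 b, ∏ w, B (cubeVertex a b w) := by
          rw [expect_fin_succ]
          refine expect_congr rfl fun y₀ _ => ?_
          rw [expect_comm]
          refine expect_congr rfl fun a _ => ?_
          rw [expect_fin_succ]

end Box

section PrimeBox

open Finset

lemma abs_prod_sub_prod_le {ι : Type*} (s : Finset ι) (f g : ι → ℝ) (hf : ∀ i, |f i| ≤ 1)
    (hg : ∀ i, |g i| ≤ 1) : |∏ i ∈ s, f i - ∏ i ∈ s, g i| ≤ ∑ i ∈ s, |f i - g i| := by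
  classical
  induction s using Finset.induction_on with
  | empty => simp
  | insert a s ha ih =>
    rw [prod_insert ha, prod_insert ha, sum_insert ha]
    have hgp : |∏ i ∈ s, g i| ≤ 1 := by
      rw [abs_prod]
      exact prod_le_one (fun _ _ => abs_nonneg _) fun i _ => hg i
    calc |f a * ∏ i ∈ s, f i - g a * ∏ i ∈ s, g i|
        = |f a * (∏ i ∈ s, f i - ∏ i ∈ s, g i) + (f a - g a) * ∏ i ∈ s, g i| := by
          congr 1; ring
      _ ≤ |f a| * |∏ i ∈ s, f i - ∏ i ∈ s, g i| + |f a - g a| * |∏ i ∈ s, g i| := by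
          rw [← abs_mul, ← abs_mul]; exact abs_add_le _ _
      _ ≤ 1 * (∑ i ∈ s, |f i - g i|) + |f a - g a| * 1 := by
          gcongr
          exact hf a
      _ = _ := by ring

variable {p : ℕ} [Fact p.Prime]

/-- The indicator function of the nonzero squares modulo `p`, minus its mean. -/
noncomputable def balancedResidue (p : ℕ) [Fact p.Prime] (v : ZMod p) : ℝ :=
  (if quadraticChar (ZMod p) v = 1 then 1 else 0) - (p - 1) / (2 * p)

lemma abs_quadraticChar_le_one (v : ZMod p) : |(quadraticChar (ZMod p) v : ℝ)| ≤ 1 := by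
  by_cases hv : v = 0
  · simp [hv]
  · rcases quadraticChar_dichotomy hv with hd | hd <;> simp [hd]

lemma abs_balancedResidue_le_one (v : ZMod p) : |balancedResidue p v| ≤ 1 := by
  have hp : (1 : ℝ) ≤ p := by exact_mod_cast (Fact.out : p.Prime).one_le
  have h1 : 0 ≤ ((p : ℝ) - 1) / (2 * p) := div_nonneg (by linarith) (by linarith)
  have h2 : ((p : ℝ) - 1) / (2 * p) ≤ 1 := by rw [div_le_one (by linarith)]; linarith
  unfold balancedResidue
  split_ifs <;> rw [abs_le] <;> constructor <;> linarith

lemma balancedResidue_sub (v : ZMod p) :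
    balancedResidue p v - quadraticChar (ZMod p) v / 2 =
      1 / (2 * p) - if v = 0 then 1 / 2 else 0 := by
  have hp : (p : ℝ) ≠ 0 := by exact_mod_cast (Fact.out : p.Prime).ne_zero
  unfold balancedResidue
  by_cases hv : v = 0
  · simp [hv]; field_simp; ring
  · rcases quadraticChar_dichotomy hv with hd | hd <;> simp [hd, hv] <;> field_simp <;> ring

lemma sum_balancedResidue (hp2 : p ≠ 2) : ∑ v : ZMod p, balancedResidue p v = 0 := by
  have hp : (p : ℝ) ≠ 0 := by exact_mod_cast (Fact.out : p.Prime).ne_zero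
  have h1 : ∑ v : ZMod p, balancedResidue p v =
      ∑ v : ZMod p, ((quadraticChar (ZMod p) v : ℝ) / 2 +
        (1 / (2 * p) - if v = 0 then 1 / 2 else 0)) :=
    sum_congr rfl fun v _ => by rw [← balancedResidue_sub]; ring
  have hchar : ringChar (ZMod p) ≠ 2 := by rwa [ZMod.ringChar_zmod_n]
  have h2 : ∑ v : ZMod p, (quadraticChar (ZMod p) v : ℝ) = 0 := by
    exact_mod_cast quadraticChar_sum_zero hchar
  rw [h1, sum_add_distrib, ← sum_div, h2, sum_sub_distrib]
  simp [ZMod.card]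
  field_simp
  norm_num

lemma sum_abs_balancedResidue_sub_le (c : ZMod p) :
    ∑ s : ZMod p, |balancedResidue p (s + c) - quadraticChar (ZMod p) (s + c) / 2| ≤ 1 := by
  have hp : (p : ℝ) ≠ 0 := by exact_mod_cast (Fact.out : p.Prime).ne_zero
  have hshift := Equiv.sum_comp (Equiv.addRight c)
    fun s => |balancedResidue p s - quadraticChar (ZMod p) s / 2|
  simp only [Equiv.coe_addRight] at hshift
  rw [hshift]
  calc ∑ s : ZMod p, |balancedResidue p s - quadraticChar (ZMod p) s / 2|
      ≤ ∑ s : ZMod p, ((1 : ℝ) / (2 * p) + if s = 0 then 1 / 2 else 0) := by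
        refine sum_le_sum fun s _ => ?_
        rw [balancedResidue_sub]
        refine (abs_sub _ _).trans ?_
        rw [abs_of_nonneg (by positivity), abs_of_nonneg (by split_ifs <;> norm_num)]
    _ = 1 := by
        rw [sum_add_distrib]
        simp [ZMod.card]
        field_simp
        norm_num
    _ ≤ 1 := le_rfl

open Polynomial in
lemma abs_sum_prod_quadraticChar_le {ι : Type*} [Fintype ι] (hp2 : p ≠ 2) (c : ι → ZMod p) (i₀ : ι)
    (hc : ∀ i, i ≠ i₀ → c i ≠ c i₀) :
    |∑ s : ZMod p, ∏ i, (quadraticChar (ZMod p) (s + c i) : ℝ)| ≤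
      27 * Fintype.card ι * √p := by
  classical
  set f : (ZMod p)[X] := ((univ.val.map fun i => -c i).map fun a => X - C a).prod with hf
  have hroots : f.roots = univ.val.map fun i => -c i := roots_multiset_prod_X_sub_C _
  have hcount : f.rootMultiplicity (-c i₀) = 1 := by
    rw [← count_roots, hroots, Multiset.count_map]
    have : (univ.val.filter fun i => -c i₀ = -c i) = ({i₀} : Multiset ι) := by
      have h1 : univ.filter (fun i => -c i₀ = -c i) = {i₀} := by
        ext i
        simp only [mem_filter, mem_univ, true_and, neg_inj, mem_singleton]
        exact ⟨fun h => by by_contra hne; exact hc i hne h.symm, fun h => by rw [h]⟩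
      simpa using congrArg Finset.val h1
    rw [this]; simp
  have hdeg : f.natDegree ≤ Fintype.card ι := by
    rw [hf, natDegree_multiset_prod_X_sub_C_eq_card]
    simp
  have heval : ∀ s, f.eval s = ∏ i, (s + c i) := fun s => by
    simp [hf, eval_prod]
  have := abs_sum_quadraticChar_le hp2 (f := f) (a := -c i₀) (by rw [hcount]; exact odd_one) hdeg
  simpa [heval, map_prod] using this

lemma abs_sum_prod_balancedResidue_le {ι : Type*} [Fintype ι] (hp2 : p ≠ 2) (c : ι → ZMod p)
    (i₀ : ι) (hc : ∀ i, i ≠ i₀ → c i ≠ c i₀) :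
    |∑ s : ZMod p, ∏ i, balancedResidue p (s + c i)| ≤ 28 * Fintype.card ι * √p := by
  have hs1 : 1 ≤ √(p : ℝ) := Real.one_le_sqrt.2 (by exact_mod_cast (Fact.out : p.Prime).one_le)
  have h1 := abs_sum_prod_quadraticChar_le hp2 c i₀ hc
  have h2 : |∑ s : ZMod p, ∏ i, ((quadraticChar (ZMod p) (s + c i) : ℝ) / 2)| ≤
      27 * Fintype.card ι * √p := by
    simp only [prod_div_distrib, ← sum_div]
    rw [abs_div]
    refine le_trans (div_le_self (abs_nonneg _) ?_) h1
    rw [abs_of_nonneg (by positivity)]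
    simpa using one_le_pow₀ (M₀ := ℝ) (one_le_two)
  have h3 : |∑ s : ZMod p, ∏ i, balancedResidue p (s + c i) -
      ∑ s : ZMod p, ∏ i, ((quadraticChar (ZMod p) (s + c i) : ℝ) / 2)| ≤ Fintype.card ι := by
    rw [← sum_sub_distrib]
    calc _ ≤ ∑ s : ZMod p, |∏ i, balancedResidue p (s + c i) -
          ∏ i, ((quadraticChar (ZMod p) (s + c i) : ℝ) / 2)| := abs_sum_le_sum_abs _ _
      _ ≤ ∑ s : ZMod p, ∑ i, |balancedResidue p (s + c i) -
          (quadraticChar (ZMod p) (s + c i) : ℝ) / 2| := by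
          refine sum_le_sum fun s _ => abs_prod_sub_prod_le _ _ _
            (fun i => abs_balancedResidue_le_one _) fun i => ?_
          rw [abs_div, abs_two]
          have := abs_quadraticChar_le_one (s + c i)
          linarith
      _ ≤ ∑ i : ι, (1 : ℝ) := by
          rw [sum_comm]
          exact sum_le_sum fun i _ => sum_abs_balancedResidue_sub_le (c i)
      _ = Fintype.card ι := by simp
  have h4 : (Fintype.card ι : ℝ) ≤ Fintype.card ι * √p :=
    le_mul_of_one_le_right (Nat.cast_nonneg _) hs1
  have h5 := abs_sub_abs_le_abs_sub (∑ s : ZMod p, ∏ i, balancedResidue p (s + c i))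
    (∑ s : ZMod p, ∏ i, ((quadraticChar (ZMod p) (s + c i) : ℝ) / 2))
  linarith

/-- The balanced residue function along the progression `8 t + 1`. -/
noncomputable def balancedResidueAt (p : ℕ) [Fact p.Prime] (t : ZMod p) : ℝ :=
  balancedResidue p (8 * t + 1)

lemma eight_ne_zero_zmod (hp2 : p ≠ 2) : (8 : ZMod p) ≠ 0 := by
  intro h
  have h1 : ((8 : ℕ) : ZMod p) = 0 := by exact_mod_cast h
  rw [ZMod.natCast_eq_zero_iff] at h1
  have h2 : p ∣ 2 := (Fact.out : p.Prime).dvd_of_dvd_pow (show p ∣ 2 ^ 3 by simpa using h1)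
  exact hp2 ((Nat.prime_dvd_prime_iff_eq Fact.out Nat.prime_two).1 h2)

lemma sum_comp_affine (hp2 : p ≠ 2) (g : ZMod p → ℝ) : ∑ t : ZMod p, g (8 * t + 1) = ∑ t, g t :=
  Equiv.sum_comp ((Equiv.mulLeft₀ 8 (eight_ne_zero_zmod hp2)).trans (Equiv.addRight 1)) g

lemma sum_balancedResidueAt (hp2 : p ≠ 2) : ∑ t : ZMod p, balancedResidueAt p t = 0 := by
  rw [← sum_balancedResidue hp2]
  exact sum_comp_affine hp2 (balancedResidue p)

lemma abs_sum_prod_balancedResidueAt_le {ι : Type*} [Fintype ι] (hp2 : p ≠ 2) (c : ι → ZMod p)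
    (i₀ : ι) (hc : ∀ i, i ≠ i₀ → c i ≠ c i₀) :
    |∑ s : ZMod p, ∏ i, balancedResidueAt p (s + c i)| ≤ 28 * Fintype.card ι * √p := by
  have h1 := abs_sum_prod_balancedResidue_le hp2 (fun i => 8 * c i) i₀
    fun i hi => (mul_right_injective₀ (eight_ne_zero_zmod hp2)).ne (hc i hi)
  rw [← sum_comp_affine hp2] at h1
  have h2 : ∀ s i, balancedResidueAt p (s + c i) = balancedResidue p (8 * s + 1 + 8 * c i) :=
    fun s i => by
      unfold balancedResidueAt
      congr 1
      ring
  simpa only [h2] using h1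

end PrimeBox

section PrimeBoxAverage

open Finset

variable {p : ℕ} [Fact p.Prime]

lemma expect_add_right {V : Type*} [Fintype V] [AddGroup V] (g : V → ℝ) (d : V) :
    𝔼 v, g (v + d) = 𝔼 v, g v :=
  Fintype.expect_equiv (Equiv.addRight d) _ _ fun _ => rfl

lemma expect_ite_eq_zero {V : Type*} [Fintype V] [Nonempty V] [AddGroup V] (g : V → ZMod p)
    (d : ZMod p → V) (c : ZMod p) (hc : c ≠ 0) (hg : ∀ v s, g (v + d s) = g v + c * s) :
    𝔼 v, (if g v = 0 then (1 : ℝ) else 0) = 1 / p := by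
  have h1 : ∀ s : ZMod p, 𝔼 v, (if g v = 0 then (1 : ℝ) else 0) =
      𝔼 v, (if g v + c * s = 0 then (1 : ℝ) else 0) := fun s => by
    rw [← expect_add_right _ (d s)]
    simp only [hg]
  have h2 : 𝔼 v, (if g v = 0 then (1 : ℝ) else 0) =
      𝔼 s : ZMod p, 𝔼 v, (if g v + c * s = 0 then (1 : ℝ) else 0) := by
    simp only [← h1, Fintype.expect_const]
  rw [h2, expect_comm]
  have h3 : ∀ v, 𝔼 s : ZMod p, (if g v + c * s = 0 then (1 : ℝ) else 0) = 1 / p := fun v => by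
    have h4 : ∀ s : ZMod p, g v + c * s = 0 ↔ s = -g v / c := fun s => by
      rw [eq_div_iff hc, mul_comm s c]
      constructor
      · intro h; linear_combination h
      · intro h; linear_combination h
    simp only [h4, Fintype.expect_eq_sum_div_card]
    simp [ZMod.card]
  simp only [h3, Fintype.expect_const]

lemma cubeVertex_add {k : ℕ} {V : Type*} [Add V] (a b d : Fin k → V) (w : Fin k → Bool) :
    cubeVertex (a + d) (b + d) w = cubeVertex a b w + d := by
  ext i
  simp only [cubeVertex, Pi.add_apply]
  split_ifs <;> rfl

lemma sum_mul_add_single {k : ℕ} (q h : Fin k → ZMod p) (i : Fin k) (s : ZMod p) :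
    ∑ j, q j * (h + Pi.single i s : Fin k → ZMod p) j = ∑ j, q j * h j + q i * s := by
  simp only [Pi.add_apply, mul_add, sum_add_distrib]
  congr 1
  rw [Finset.sum_eq_single i] <;> simp +contextual

/-- The average of the balanced residue function over boxes exhibits square root cancellation. -/
lemma abs_expect_prod_box_le (hp2 : p ≠ 2) {k : ℕ} (hk : 0 < k) (q : Fin k → ZMod p)
    (hq : ∀ i, q i ≠ 0) (n : ZMod p) :
    |𝔼 a : Fin k → ZMod p, 𝔼 b : Fin k → ZMod p,
      ∏ w, balancedResidueAt p (n + ∑ i, q i * cubeVertex a b w i)| ≤ 29 * 2 ^ k / √p := by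
  classical
  have hp1 : (1 : ℝ) ≤ p := by exact_mod_cast (Fact.out : p.Prime).one_le
  have hp0 : (0 : ℝ) < p := by linarith
  have hs1 : 1 ≤ √(p : ℝ) := Real.one_le_sqrt.2 hp1
  have hs2 : √(p : ℝ) * √p = p := Real.mul_self_sqrt hp0.le
  set L : (Fin k → ZMod p) → (Fin k → ZMod p) → (Fin k → Bool) → ZMod p :=
    fun a b w => n + ∑ i, q i * cubeVertex a b w i with hL
  set w₀ : Fin k → Bool := fun _ => false with hw₀
  set i₀ : Fin k := ⟨0, hk⟩
  have h1 : ∀ s, q i₀ * (s / q i₀) = s := fun s => by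
    rw [mul_div_assoc', mul_div_cancel_left₀ _ (hq i₀)]
  have hshift : ∀ s : ZMod p, 𝔼 a, 𝔼 b, ∏ w, balancedResidueAt p (L a b w) =
      𝔼 a, 𝔼 b, ∏ w, balancedResidueAt p (s + L a b w) := fun s => by
    rw [← expect_add_right _ (Pi.single i₀ (s / q i₀))]
    refine expect_congr rfl fun a _ => ?_
    rw [← expect_add_right _ (Pi.single i₀ (s / q i₀))]
    refine expect_congr rfl fun b _ => prod_congr rfl fun w _ => ?_
    simp only [hL, cubeVertex_add, sum_mul_add_single, h1]
    congr 1
    ring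
  have haverage : 𝔼 a, 𝔼 b, ∏ w, balancedResidueAt p (L a b w) =
      𝔼 a, 𝔼 b, 𝔼 s : ZMod p, ∏ w, balancedResidueAt p (s + L a b w) := by
    calc _ = 𝔼 s : ZMod p, 𝔼 a, 𝔼 b, ∏ w, balancedResidueAt p (s + L a b w) := by
          simp only [← hshift, Fintype.expect_const]
      _ = _ := by
          rw [expect_comm]
          exact expect_congr rfl fun a _ => expect_comm _ _ _
  have hinner : ∀ a b, |𝔼 s : ZMod p, ∏ w, balancedResidueAt p (s + L a b w)| ≤
      28 * 2 ^ k / √p + ∑ w with w ≠ w₀, if L a b w - L a b w₀ = 0 then (1 : ℝ) else 0 := by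
    intro a b
    by_cases hgood : ∀ w, w ≠ w₀ → L a b w ≠ L a b w₀
    · have h1 := abs_sum_prod_balancedResidueAt_le hp2 (L a b) w₀ hgood
      have h2 : 0 ≤ ∑ w with w ≠ w₀, if L a b w - L a b w₀ = 0 then (1 : ℝ) else 0 :=
        sum_nonneg fun w _ => by split_ifs <;> norm_num
      rw [Fintype.expect_eq_sum_div_card, abs_div, Nat.abs_cast, ZMod.card]
      have h3 : 28 * (Fintype.card (Fin k → Bool) : ℝ) * √p / p = 28 * 2 ^ k / √p := by
        rw [div_eq_div_iff hp0.ne' (by positivity)]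
        simp only [Fintype.card_pi, Fintype.card_bool, prod_const, card_univ, Fintype.card_fin]
        push_cast
        linear_combination 28 * (2 : ℝ) ^ k * hs2
      have h4 := div_le_div_of_nonneg_right h1 hp0.le
      linarith
    · push Not at hgood
      obtain ⟨w, hw, hLw⟩ := hgood
      have h1 : (1 : ℝ) ≤ ∑ w with w ≠ w₀, if L a b w - L a b w₀ = 0 then (1 : ℝ) else 0 := by
        refine le_trans ?_ (single_le_sum (f := fun w => if L a b w - L a b w₀ = 0 then (1 : ℝ)
          else 0) (fun w _ => by split_ifs <;> norm_num)
          (show w ∈ _ by simpa using hw))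
        simp [hLw]
      have h2 : |𝔼 s : ZMod p, ∏ w, balancedResidueAt p (s + L a b w)| ≤ 1 := by
        refine (abs_expect_le _ _).trans (expect_le univ_nonempty fun s _ => ?_)
        rw [abs_prod]
        exact prod_le_one (fun _ _ => abs_nonneg _) fun w _ => abs_balancedResidue_le_one _
      have h3 : 0 ≤ 28 * 2 ^ k / √(p : ℝ) := by positivity
      linarith
  have hbad : ∀ a, ∀ w, w ≠ w₀ →
      𝔼 b, (if L a b w - L a b w₀ = 0 then (1 : ℝ) else 0) = 1 / p := by
    intro a w hw
    obtain ⟨i, hi⟩ : ∃ i, w i = true := by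
      by_contra! h
      exact hw (funext fun i => by simpa using h i)
    refine expect_ite_eq_zero _ (fun s => Pi.single i s) (q i) (hq i) fun b s => ?_
    have h1 : cubeVertex a (b + Pi.single i s) w = cubeVertex a b w + Pi.single i s := by
      ext j
      by_cases hj : j = i
      · subst hj; simp [cubeVertex, hi]
      · simp [cubeVertex, hj]
    have h2 : ∀ b', cubeVertex a b' w₀ = a := fun b' => by ext j; simp [cubeVertex, hw₀]
    simp only [hL, h1, h2, sum_mul_add_single]
    ring
  rw [haverage]
  calc _ ≤ 𝔼 a, 𝔼 b, |𝔼 s : ZMod p, ∏ w, balancedResidueAt p (s + L a b w)| :=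
        (abs_expect_le _ _).trans (expect_le_expect fun a _ => abs_expect_le _ _)
    _ ≤ 𝔼 a, 𝔼 b, (28 * 2 ^ k / √p +
          ∑ w with w ≠ w₀, if L a b w - L a b w₀ = 0 then (1 : ℝ) else 0) :=
        expect_le_expect fun a _ => expect_le_expect fun b _ => hinner a b
    _ = 28 * 2 ^ k / √p + ∑ w : Fin k → Bool with w ≠ w₀, 1 / (p : ℝ) := by
        have h1 : ∀ a, 𝔼 b, (28 * 2 ^ k / √p +
            ∑ w with w ≠ w₀, if L a b w - L a b w₀ = 0 then (1 : ℝ) else 0) =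
            28 * 2 ^ k / √p + ∑ w : Fin k → Bool with w ≠ w₀, 1 / (p : ℝ) := fun a => by
          rw [expect_add_distrib, Fintype.expect_const, expect_sum_comm]
          congr 1
          exact sum_congr rfl fun w hw => hbad a w (by simpa using hw)
        simp only [h1, Fintype.expect_const]
    _ ≤ 28 * 2 ^ k / √p + 2 ^ k * (1 / p) := by
        gcongr
        rw [sum_const, nsmul_eq_mul]
        gcongr
        have := card_filter_le (univ : Finset (Fin k → Bool)) (fun w => w ≠ w₀)
        simp only [card_univ, Fintype.card_pi, Fintype.card_bool, prod_const,
          Fintype.card_fin] at this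
        exact_mod_cast this
    _ ≤ 28 * 2 ^ k / √p + 2 ^ k * (1 / √p) := by
        gcongr
        nlinarith
    _ = 29 * 2 ^ k / √p := by ring

end PrimeBoxAverage

section IntervalSums

open Finset

instance factPrimePrimes (p : Nat.Primes) : Fact (p : ℕ).Prime := ⟨p.2⟩

lemma abs_sum_Ico_shift_sub_le (g : ℕ → ℝ) (hg : ∀ t, |g t| ≤ 1) (a b m : ℕ) :
    |∑ t ∈ Ico a b, g (t + m) - ∑ t ∈ Ico a b, g t| ≤ 2 * m := by
  rcases le_total b a with hab | hab
  · simp [Ico_eq_empty_of_le hab]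
  induction m with
  | zero => simp
  | succ m ih =>
    have h1 : ∑ t ∈ Ico a b, g (t + (m + 1)) - ∑ t ∈ Ico a b, g (t + m) =
        g (b + m) - g (a + m) := by
      rw [← sum_sub_distrib, ← sum_Ico_sub (fun t => g (t + m)) hab]
      refine sum_congr rfl fun t _ => ?_
      rw [show t + (m + 1) = t + 1 + m by ring]
    have h2 := abs_le.1 (hg (b + m))
    have h3 := abs_le.1 (hg (a + m))
    rw [abs_le] at ih ⊢
    push_cast
    constructor <;> linarith

/-- Interval sums of a bounded function are controlled by its averages over short shifts. -/
lemma abs_sum_Ico_le_of_expect {Y : Type*} [Fintype Y] [Nonempty Y] (g : ℕ → ℝ)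
    (hg : ∀ t, |g t| ≤ 1) (m : Y → ℕ) {M β : ℝ} (hm : ∀ y, (m y : ℝ) ≤ M)
    (hβ : ∀ t, |𝔼 y, g (t + m y)| ≤ β) (a b : ℕ) :
    |∑ t ∈ Ico a b, g t| ≤ 2 * M + (b - a : ℕ) * β := by
  have h1 : ∑ t ∈ Ico a b, g t =
      𝔼 y, (∑ t ∈ Ico a b, g t - ∑ t ∈ Ico a b, g (t + m y)) +
        ∑ t ∈ Ico a b, 𝔼 y, g (t + m y) := by
    rw [expect_sub_distrib, Fintype.expect_const, expect_sum_comm]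
    ring
  have h2 : |𝔼 y, (∑ t ∈ Ico a b, g t - ∑ t ∈ Ico a b, g (t + m y))| ≤ 2 * M := by
    refine (abs_expect_le _ _).trans (expect_le univ_nonempty fun y _ => ?_)
    rw [abs_sub_comm]
    exact (abs_sum_Ico_shift_sub_le g hg a b (m y)).trans (by linarith [hm y])
  have h3 : |∑ t ∈ Ico a b, 𝔼 y, g (t + m y)| ≤ (b - a : ℕ) * β := by
    refine (abs_sum_le_sum_abs _ _).trans ((sum_le_sum fun t _ => hβ t).trans ?_)
    simp
  rw [h1]
  exact (abs_add_le _ _).trans (add_le_add h2 h3)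

lemma expect_prod_pi {ι κ : Type*} [Fintype ι] [Fintype κ] [DecidableEq ι] [DecidableEq κ]
    {V : κ → Type*} [∀ j, Fintype (V j)] (g : ∀ j, (ι → V j) → ℝ) :
    𝔼 a : ι → ∀ j, V j, ∏ j, g j (fun i => a i j) = ∏ j, 𝔼 u, g j u := by
  rw [Fintype.expect_equiv (Equiv.piComm fun (_ : ι) (j : κ) => V j)
    (fun a : ι → ∀ j, V j => ∏ j, g j (fun i => a i j)) (fun u => ∏ j, g j (u j)) fun a => rfl]
  simp only [Fintype.expect_eq_sum_div_card, prod_div_distrib, Fintype.prod_sum]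
  congr 1
  rw [Fintype.card_pi]
  push_cast
  rfl

/-- The product of the balanced residue functions over a finite set of primes. -/
noncomputable def residueProd (P : Finset Nat.Primes) (t : ℕ) : ℝ :=
  ∏ p ∈ P, balancedResidueAt (p : ℕ) (t : ZMod p)

lemma abs_residueProd_le_one (P : Finset Nat.Primes) (t : ℕ) : |residueProd P t| ≤ 1 := by
  rw [residueProd, abs_prod]
  exact prod_le_one (fun _ _ => abs_nonneg _) fun p _ => abs_balancedResidue_le_one _

/-- The product of a finite set of primes. -/
def primesProd (P : Finset Nat.Primes) : ℕ := ∏ p ∈ P, (p : ℕ)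

lemma primesProd_pos (P : Finset Nat.Primes) : 0 < primesProd P :=
  prod_pos fun p _ => p.2.pos

lemma primesProd_cast_eq_zero {P : Finset Nat.Primes} {p : Nat.Primes} (hp : p ∈ P) :
    (primesProd P : ZMod p) = 0 := by
  rw [ZMod.natCast_eq_zero_iff]
  exact dvd_prod_of_mem _ hp

lemma primesProd_cast_ne_zero {P : Finset Nat.Primes} {p : Nat.Primes} (hp : p ∉ P) :
    (primesProd P : ZMod p) ≠ 0 := by
  rw [Ne, ZMod.natCast_eq_zero_iff, primesProd, Prime.dvd_finsetProd_iff p.2.prime]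
  rintro ⟨r, hr, hpr⟩
  rw [Nat.prime_dvd_prime_iff_eq p.2 r.2] at hpr
  exact hp (Nat.Primes.coe_nat_injective hpr ▸ hr)

lemma abs_sum_residueProd_le_primesProd {P : Finset Nat.Primes} (hP : P.Nonempty)
    (hodd : ∀ p ∈ P, (p : ℕ) ≠ 2) (a b : ℕ) :
    |∑ t ∈ Ico a b, residueProd P t| ≤ 2 * primesProd P := by
  classical
  obtain ⟨p, hp⟩ := hP
  have h1 := abs_sum_Ico_le_of_expect (Y := ZMod p) (residueProd P) (abs_residueProd_le_one P)
    (fun s => s.val * primesProd (P.erase p)) (M := primesProd P) (β := 0) ?_ ?_ a b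
  · simpa using h1
  · intro s
    rw [primesProd, primesProd, ← mul_prod_erase P (fun r : Nat.Primes => (r : ℕ)) hp]
    have := (ZMod.val_lt s).le
    gcongr
  · intro t
    rw [abs_nonpos_iff]
    set c : ZMod p := ((primesProd (P.erase p) : ℕ) : ZMod p) with hcdef
    have hc : c ≠ 0 := primesProd_cast_ne_zero (notMem_erase p P)
    have h2 : ∀ s : ZMod p, residueProd P (t + s.val * primesProd (P.erase p)) =
        balancedResidueAt p (t + s * c) * residueProd (P.erase p) t := fun s => by
      rw [residueProd, ← mul_prod_erase P _ hp]
      congr 1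
      · push_cast
        rw [ZMod.natCast_zmod_val]
      · refine prod_congr rfl fun r hr => ?_
        push_cast
        rw [primesProd_cast_eq_zero hr, mul_zero, add_zero]
    simp only [h2, ← expect_mul]
    have h3 : ∑ s : ZMod p, balancedResidueAt p (t + s * c) = 0 :=
      (Equiv.sum_comp ((Equiv.mulRight₀ c hc).trans (Equiv.addLeft (t : ZMod p)))
        (balancedResidueAt (p : ℕ))).trans (sum_balancedResidueAt (hodd p hp))
    rw [Fintype.expect_eq_sum_div_card, h3, zero_div, zero_mul]

section Blocks

variable {T : Finset Nat.Primes}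

/-- The integer with prescribed residues, up to units, modulo the primes of `T`. -/
def combineResidues (x : ∀ p : T, ZMod (p : Nat.Primes)) : ℕ :=
  ∑ p : T, (x p).val * primesProd (T.erase p)

lemma combineResidues_le (x : ∀ p : T, ZMod (p : Nat.Primes)) :
    combineResidues x ≤ #T * primesProd T := by
  unfold combineResidues
  calc _ ≤ ∑ p : T, primesProd T := sum_le_sum fun p _ => by
        unfold primesProd
        rw [← mul_prod_erase T (fun r : Nat.Primes => (r : ℕ)) p.2]
        exact Nat.mul_le_mul_right _ (ZMod.val_lt _).le
    _ = _ := by simp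

lemma combineResidues_cast (x : ∀ p : T, ZMod (p : Nat.Primes)) (p : T) :
    (combineResidues x : ZMod (p : Nat.Primes)) = x p * primesProd (T.erase p) := by
  unfold combineResidues
  push_cast
  rw [sum_eq_single p, ZMod.natCast_zmod_val]
  · intro r _ hr
    rw [primesProd_cast_eq_zero, mul_zero]
    exact mem_erase.2 ⟨fun h => hr (Subtype.ext h.symm), p.2⟩
  · simp

/-- The `2 ^ k`-th power of the average over shifts is controlled by the primes of one block. -/
lemma expect_residueProd_pow_le {k : ℕ} (hk : 0 < k) {P : Finset Nat.Primes} (hT : T ⊆ P)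
    (hodd : ∀ p ∈ P, (p : ℕ) ≠ 2) (c : Nat.Primes → Fin k) (t : ℕ) :
    (𝔼 h : Fin k → ∀ p : T, ZMod (p : Nat.Primes), residueProd P
      (t + ∑ j, primesProd {p ∈ P \ T | c p = j} * combineResidues (h j))) ^ 2 ^ k ≤
      ∏ p ∈ T, min 1 (29 * 2 ^ k / √(p : ℕ)) := by
  classical
  set Q : Fin k → Finset Nat.Primes := fun j => {p ∈ P \ T | c p = j} with hQ
  set m : (Fin k → ∀ p : T, ZMod (p : Nat.Primes)) → ℕ :=
    fun h => ∑ j, primesProd (Q j) * combineResidues (h j) with hm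
  have hsplit : ∀ n, residueProd P n = (∏ j, residueProd (Q j) n) * residueProd T n := fun n => by
    simp only [residueProd, hQ]
    rw [prod_fiberwise, prod_sdiff hT]
  have h1 := expect_prod_mul_pow_le k (fun j h => residueProd (Q j) (t + m h))
    (fun h => residueProd T (t + m h)) (fun j h => abs_residueProd_le_one _ _) ?_
  · simp only [← hsplit] at h1
    refine h1.trans ?_
    set f : ∀ p : T, (Fin k → ZMod (p : Nat.Primes)) → ℝ := fun p u =>
      balancedResidueAt (p : Nat.Primes)
        (t + ∑ i, (primesProd (Q i) * primesProd (T.erase p) : ZMod (p : Nat.Primes)) * u i) with hf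
    have hB : ∀ h, residueProd T (t + m h) = ∏ p : T, f p (fun i => h i p) := fun h => by
      rw [residueProd, ← prod_coe_sort]
      refine prod_congr rfl fun p _ => ?_
      simp only [hf, hm]
      push_cast
      congr 2
      refine sum_congr rfl fun i _ => ?_
      rw [combineResidues_cast]
      ring
    have hfactor : 𝔼 a, 𝔼 b, ∏ w, residueProd T (t + m (cubeVertex a b w)) =
        ∏ p : T, 𝔼 a, 𝔼 b, ∏ w, f p (cubeVertex a b w) := by
      rw [← expect_prod_pi]
      refine expect_congr rfl fun a _ => ?_
      rw [← expect_prod_pi (fun (p : T) b => ∏ w, f p (cubeVertex (fun i => a i p) b w))]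
      refine expect_congr rfl fun b _ => ?_
      rw [prod_comm]
      refine prod_congr rfl fun w _ => ?_
      rw [hB]
      refine prod_congr rfl fun p _ => ?_
      congr 1
      ext i
      simp only [cubeVertex]
      split_ifs <;> rfl
    rw [hfactor, ← prod_coe_sort T fun p : Nat.Primes => min 1 (29 * 2 ^ k / √(p : ℕ))]
    refine (le_abs_self _).trans ?_
    rw [abs_prod]
    refine prod_le_prod (fun _ _ => abs_nonneg _) fun p _ => le_min ?_ ?_
    · refine (abs_expect_le _ _).trans (expect_le univ_nonempty fun a _ =>
        (abs_expect_le _ _).trans (expect_le univ_nonempty fun b _ => ?_))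
      rw [abs_prod]
      exact prod_le_one (fun _ _ => abs_nonneg _) fun w _ => abs_balancedResidue_le_one _
    · refine abs_expect_prod_box_le (hodd p (hT p.2)) hk _ (fun i => mul_ne_zero
        (primesProd_cast_ne_zero ?_) (primesProd_cast_ne_zero (notMem_erase _ _))) _
      simp [hQ, p.2]
  · intro j h x
    refine prod_congr rfl fun p hp => ?_
    simp only [hm]
    push_cast
    congr 2
    refine sum_congr rfl fun i _ => ?_
    by_cases hij : i = j
    · rw [hij, primesProd_cast_eq_zero hp, zero_mul, zero_mul]
    · rw [Function.update_of_ne hij]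

lemma abs_sum_residueProd_le_of_blocks {k : ℕ} (hk : 0 < k) {P : Finset Nat.Primes} (hT : T ⊆ P)
    (hodd : ∀ p ∈ P, (p : ℕ) ≠ 2) (c : Nat.Primes → Fin k) {y β : ℝ} (hTy : primesProd T ≤ y)
    (hcy : ∀ j, (primesProd {p ∈ P \ T | c p = j} : ℝ) ≤ y) (hβ0 : 0 ≤ β)
    (hβ : ∏ p ∈ T, min 1 (29 * 2 ^ k / √(p : ℕ)) ≤ β ^ 2 ^ k) (a b : ℕ) :
    |∑ t ∈ Ico a b, residueProd P t| ≤ 2 * (k * #T * y ^ 2) + (b - a : ℕ) * β := by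
  refine abs_sum_Ico_le_of_expect (Y := Fin k → ∀ p : T, ZMod (p : Nat.Primes)) (residueProd P)
    (abs_residueProd_le_one P)
    (fun h => ∑ j, primesProd {p ∈ P \ T | c p = j} * combineResidues (h j)) (fun h => ?_)
    (fun t => ?_) a b
  · push_cast
    have hy0 : 0 ≤ y := (Nat.cast_nonneg _).trans hTy
    calc _ ≤ ∑ j : Fin k, y * (#T * y) := by
          refine sum_le_sum fun j _ => mul_le_mul (hcy j) ?_ (Nat.cast_nonneg _) hy0
          have h1 : (combineResidues (h j) : ℝ) ≤ #T * primesProd T := by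
            exact_mod_cast combineResidues_le (h j)
          exact h1.trans (by gcongr)
      _ = k * #T * y ^ 2 := by
          rw [sum_const, card_univ, Fintype.card_fin, nsmul_eq_mul]
          ring
  · have h1 := (expect_residueProd_pow_le hk hT hodd c t).trans hβ
    rw [← Even.pow_abs (Nat.even_pow.2 ⟨even_two, hk.ne'⟩)] at h1
    exact (pow_le_pow_iff_left₀ (abs_nonneg _) hβ0 (by positivity)).1 h1

end Blocks

end IntervalSums

section BlockSelection

open Finset

lemma primesProd_insert {P : Finset Nat.Primes} {r : Nat.Primes} (hr : r ∉ P) :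
    primesProd (insert r P) = r * primesProd P :=
  prod_insert hr

lemma exists_subset_primesProd_le {x y : ℝ} {P : Finset Nat.Primes}
    (hx : ∀ p ∈ P, ((p : ℕ) : ℝ) ≤ x) (hP : y < primesProd P) (hy : 1 ≤ y) :
    ∃ T ⊆ P, primesProd T ≤ y ∧ y < x * primesProd T := by
  classical
  induction P using Finset.induction_on with
  | empty => simp [primesProd] at hP; linarith
  | insert r P hr ih =>
    rcases lt_or_ge y (primesProd P) with h | h
    · obtain ⟨T, hT, h1⟩ := ih (fun p hp => hx p (mem_insert_of_mem hp)) h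
      exact ⟨T, hT.trans (subset_insert _ _), h1⟩
    · refine ⟨P, subset_insert _ _, h, hP.trans_le ?_⟩
      rw [primesProd_insert hr]
      push_cast
      have := hx r (mem_insert_self _ _)
      gcongr

/-- A set of primes of bounded product can be distributed greedily among `k` blocks. -/
lemma exists_coloring_primesProd_le {x z : ℝ} {k : ℕ} (hk : 0 < k) (hz : 0 < z) (hxz : 1 ≤ x * z)
    {R : Finset Nat.Primes} (hx : ∀ p ∈ R, ((p : ℕ) : ℝ) ≤ x) (hR : (primesProd R : ℝ) ≤ z ^ k) :
    ∃ c : Nat.Primes → Fin k, ∀ j, (primesProd {p ∈ R | c p = j} : ℝ) ≤ x * z := by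
  classical
  induction R using Finset.induction_on with
  | empty => exact ⟨fun _ => ⟨0, hk⟩, fun j => by simpa [primesProd] using hxz⟩
  | insert r R hr ih =>
    rw [primesProd_insert hr] at hR
    push_cast at hR
    have hr1 : (1 : ℝ) < (r : ℕ) := by exact_mod_cast r.2.one_lt
    have hR0 : (0 : ℝ) < primesProd R := by exact_mod_cast primesProd_pos R
    have hlt : (primesProd R : ℝ) < z ^ k := by nlinarith
    obtain ⟨c, hc⟩ := ih (fun p hp => hx p (mem_insert_of_mem hp)) hlt.le
    obtain ⟨j, hj⟩ : ∃ j, (primesProd {p ∈ R | c p = j} : ℝ) ≤ z := by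
      by_contra! hall
      have h1 : z ^ k ≤ ∏ j : Fin k, (primesProd {p ∈ R | c p = j} : ℝ) := by
        have h2 : ∏ _j : Fin k, z = z ^ k := by simp
        rw [← h2]
        exact prod_le_prod (fun _ _ => hz.le) fun j _ => (hall j).le
      have h3 : ∏ j : Fin k, primesProd {p ∈ R | c p = j} = primesProd R :=
        prod_fiberwise _ _ _
      have h4 : ∏ j : Fin k, (primesProd {p ∈ R | c p = j} : ℝ) = primesProd R := by
        exact_mod_cast h3
      linarith
    refine ⟨Function.update c r j, fun i => ?_⟩
    have hfilter : {p ∈ R | Function.update c r j p = i} = {p ∈ R | c p = i} :=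
      filter_congr fun p hp => by
        rw [Function.update_of_ne (ne_of_mem_of_not_mem hp hr)]
    rw [filter_insert, Function.update_self, hfilter]
    split_ifs with hij
    · subst hij
      rw [primesProd_insert (by simp [hr])]
      push_cast
      exact mul_le_mul (hx r (mem_insert_self _ _)) hj (Nat.cast_nonneg _)
        ((Nat.cast_nonneg _).trans (hx r (mem_insert_self _ _)))
    · exact hc i

lemma primesProd_le_four_pow {P : Finset Nat.Primes} {w : ℕ} (hP : ∀ p ∈ P, (p : ℕ) ≤ w) :
    primesProd P ≤ 4 ^ w := by
  refine le_trans ?_ (primorial_le_four_pow w)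
  have h1 : primesProd P = ∏ p ∈ P.map ⟨fun p : Nat.Primes => (p : ℕ),
      Nat.Primes.coe_nat_injective⟩, p := by
    rw [prod_map]; rfl
  rw [h1, primorial]
  refine prod_le_prod_of_subset_of_one_le' ?_ ?_
  · intro n hn
    simp only [mem_map] at hn
    obtain ⟨p, hp, rfl⟩ := hn
    simpa [Nat.lt_succ_iff] using ⟨hP p hp, p.2⟩
  · intro n hn _
    exact (mem_filter.1 hn).2.one_le

lemma prod_min_le_rpow {T : Finset Nat.Primes} {K : ℝ} {w : ℕ} (hK0 : 0 ≤ K) (hK : K ^ 4 ≤ w) :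
    ∏ p ∈ T, min 1 (K / √(p : ℕ)) ≤ (primesProd T / 4 ^ w : ℝ) ^ (-(1 / 4) : ℝ) := by
  classical
  have hnn : ∀ p : Nat.Primes, 0 ≤ min 1 (K / √(p : ℕ)) := fun p => by positivity
  have hpos : ∀ S : Finset Nat.Primes, (0 : ℝ) < primesProd S := fun S => by
    exact_mod_cast primesProd_pos S
  have hlarge : ∀ p : Nat.Primes, w < (p : ℕ) →
      min 1 (K / √(p : ℕ)) ≤ ((p : ℕ) : ℝ) ^ (-(1 / 4) : ℝ) := fun p hp => by
    refine (min_le_right _ _).trans ?_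
    have hp0 : (0 : ℝ) < (p : ℕ) := by exact_mod_cast p.2.pos
    have h1 : K ≤ ((p : ℕ) : ℝ) ^ (1 / 4 : ℝ) := by
      refine le_of_pow_le_pow_left₀ (n := 4) (by norm_num) (by positivity) ?_
      rw [← Real.rpow_natCast (_ ^ _), ← Real.rpow_mul hp0.le]
      norm_num
      exact hK.trans (by exact_mod_cast hp.le)
    rw [div_le_iff₀ (by positivity), Real.sqrt_eq_rpow, ← Real.rpow_add hp0]
    norm_num
    exact h1
  have h1 : ∏ p ∈ T, min 1 (K / √(p : ℕ)) ≤
      ∏ p ∈ T.filter fun p : Nat.Primes => ¬ (p : ℕ) ≤ w, ((p : ℕ) : ℝ) ^ (-(1 / 4) : ℝ) := by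
    rw [← prod_filter_mul_prod_filter_not T fun p => (p : ℕ) ≤ w]
    calc _ ≤ 1 * ∏ p ∈ T.filter fun p : Nat.Primes => ¬ (p : ℕ) ≤ w,
          ((p : ℕ) : ℝ) ^ (-(1 / 4) : ℝ) := by
          refine mul_le_mul (prod_le_one (fun p _ => hnn p) fun p _ => min_le_left _ _)
            (prod_le_prod (fun p _ => hnn p) fun p hp => hlarge p ?_)
            (prod_nonneg fun p _ => hnn p) zero_le_one
          simpa using (mem_filter.1 hp).2
      _ = _ := one_mul _
  refine h1.trans ?_
  rw [Real.finsetProd_rpow _ _ fun p _ => Nat.cast_nonneg _]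
  have h2 : (primesProd T : ℝ) / 4 ^ w ≤ primesProd {p ∈ T | ¬ (p : ℕ) ≤ w} := by
    rw [div_le_iff₀ (by positivity)]
    have h3 : primesProd {p ∈ T | (p : ℕ) ≤ w} * primesProd {p ∈ T | ¬ (p : ℕ) ≤ w} =
        primesProd T := prod_filter_mul_prod_filter_not _ _ _
    have h4 : primesProd {p ∈ T | (p : ℕ) ≤ w} ≤ 4 ^ w :=
      primesProd_le_four_pow fun p hp => (mem_filter.1 hp).2
    have h5 : primesProd T ≤ primesProd {p ∈ T | ¬ (p : ℕ) ≤ w} * 4 ^ w := by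
      rw [← h3, mul_comm]
      exact Nat.mul_le_mul_left _ h4
    exact_mod_cast h5
  have h6 : ∏ p ∈ T.filter fun p : Nat.Primes => ¬ (p : ℕ) ≤ w, ((p : ℕ) : ℝ) =
      primesProd {p ∈ T | ¬ (p : ℕ) ≤ w} := by
    rw [primesProd]; push_cast; rfl
  rw [h6]
  exact Real.rpow_le_rpow_of_nonpos (div_pos (hpos T) (by positivity)) h2 (by norm_num)

/-- Cancellation in interval sums of products of balanced residue functions. -/
lemma abs_sum_residueProd_le {x y : ℝ} {k w : ℕ} {P : Finset Nat.Primes} (hP : P.Nonempty)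
    (hodd : ∀ p ∈ P, (p : ℕ) ≠ 2) (hx : ∀ p ∈ P, ((p : ℕ) : ℝ) ≤ x) (hcard : (#P : ℝ) ≤ x)
    (hx1 : 1 ≤ x) (hy : 1 ≤ y) (hk : 0 < k) (hw : (29 * 2 ^ k : ℝ) ^ 4 ≤ w)
    (hPy : primesProd P ≤ (y / x) ^ k) (a b : ℕ) :
    |∑ t ∈ Ico a b, residueProd P t| ≤
      2 * (k * x * y ^ 2) + (b - a : ℕ) * (y / (x * 4 ^ w)) ^ (-(1 / (4 * 2 ^ k)) : ℝ) := by
  classical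
  have hx0 : 0 < x := by linarith
  have hy0 : 0 < y := by linarith
  have hk1 : (1 : ℝ) ≤ k := by exact_mod_cast hk
  have hβ0 : 0 ≤ (y / (x * 4 ^ w)) ^ (-(1 / (4 * 2 ^ k)) : ℝ) := by positivity
  rcases le_or_gt (primesProd P : ℝ) y with hle | hgt
  · refine (abs_sum_residueProd_le_primesProd hP hodd a b).trans ?_
    have h1 : y ≤ k * x * y ^ 2 := by
      have : 1 ≤ k * x * y := one_le_mul_of_one_le_of_one_le
        (one_le_mul_of_one_le_of_one_le hk1 hx1) hy
      nlinarith
    have h2 : 0 ≤ ((b - a : ℕ) : ℝ) * (y / (x * 4 ^ w)) ^ (-(1 / (4 * 2 ^ k)) : ℝ) := by positivity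
    linarith
  · obtain ⟨T, hT, hTy, hyT⟩ := exists_subset_primesProd_le hx hgt hy
    have hxz : x * (y / x) = y := by field_simp
    have hR : (primesProd (P \ T) : ℝ) ≤ (y / x) ^ k := by
      refine le_trans ?_ hPy
      exact_mod_cast prod_le_prod_of_subset_of_one_le' sdiff_subset
        fun (p : Nat.Primes) _ _ => p.2.one_le
    obtain ⟨c, hc⟩ := exists_coloring_primesProd_le hk (div_pos hy0 hx0) (by rwa [hxz])
      (fun p hp => hx p (mem_sdiff.1 hp).1) hR
    rw [hxz] at hc
    refine (abs_sum_residueProd_le_of_blocks hk hT hodd c hTy hc hβ0 ?_ a b).trans ?_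
    · refine (prod_min_le_rpow (by positivity) hw).trans ?_
      rw [← Real.rpow_natCast (_ ^ _), ← Real.rpow_mul (by positivity)]
      have h1 : (-(1 / (4 * 2 ^ k)) : ℝ) * ((2 ^ k : ℕ) : ℝ) = -(1 / 4) := by
        push_cast
        field_simp
      rw [h1]
      refine Real.rpow_le_rpow_of_nonpos (by positivity) ?_ (by norm_num)
      rw [div_mul_eq_div_div]
      gcongr
      rw [div_le_iff₀ hx0]
      linarith
    · have h1 : (#T : ℝ) ≤ x := le_trans (by exact_mod_cast card_le_card hT) hcard
      gcongr

end BlockSelection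

section Counting

open Finset

/-- The odd primes up to `x`. -/
noncomputable def oddPrimes (x : ℝ) : Finset Nat.Primes :=
  ((primesUpTo x).erase 2).preimage (fun p : Nat.Primes => (p : ℕ))
    Nat.Primes.coe_nat_injective.injOn

lemma mem_oddPrimes {x : ℝ} {p : Nat.Primes} :
    p ∈ oddPrimes x ↔ ((p : ℕ) : ℝ) ≤ x ∧ (p : ℕ) ≠ 2 := by
  have h1 : p ∈ oddPrimes x ↔ (p : ℕ) ∈ (primesUpTo x).erase 2 := mem_preimage
  rw [h1, mem_erase, primesUpTo, mem_filter, mem_Iic, Nat.le_floor_iff' p.2.ne_zero]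
  simp [p.2, and_comm]

/-- The proportion of nonzero squares modulo `p`. -/
noncomputable def residueDensity (p : ℕ) : ℝ := (p - 1) / (2 * p)

lemma one_third_le_residueDensity {p : ℕ} (hp : 3 ≤ p) : 1 / 3 ≤ residueDensity p := by
  have : (3 : ℝ) ≤ p := by exact_mod_cast hp
  rw [residueDensity, div_le_div_iff₀ (by norm_num) (by linarith)]
  linarith

lemma residueDensity_le_one {p : ℕ} (hp : 1 ≤ p) : residueDensity p ≤ 1 := by
  have : (1 : ℝ) ≤ p := by exact_mod_cast hp
  rw [residueDensity, div_le_one (by linarith)]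
  linarith

lemma three_le_of_mem_oddPrimes {x : ℝ} {p : Nat.Primes} (hp : p ∈ oddPrimes x) : 3 ≤ (p : ℕ) := by
  have := p.2.two_le
  have := (mem_oddPrimes.1 hp).2
  omega

lemma residueDensity_nonneg (p : Nat.Primes) : 0 ≤ residueDensity p := by
  have : (1 : ℝ) ≤ (p : ℕ) := by exact_mod_cast p.2.one_le
  exact div_nonneg (by linarith) (by linarith)

/-- `8 t + 1` is a nonzero square modulo every prime in `P`. -/
def AllResidues (P : Finset Nat.Primes) (t : ℕ) : Prop :=
  ∀ p ∈ P, quadraticChar (ZMod p) (8 * t + 1) = 1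

lemma prod_density_add_eq_ite (P : Finset Nat.Primes) (t : ℕ) [Decidable (AllResidues P t)] :
    ∏ p ∈ P, (balancedResidueAt (p : ℕ) (t : ZMod p) + residueDensity p) =
      if AllResidues P t then 1 else 0 := by
  have h1 : ∀ p : Nat.Primes, balancedResidueAt (p : ℕ) (t : ZMod p) + residueDensity p =
      if quadraticChar (ZMod p) (8 * t + 1) = 1 then 1 else 0 := fun p => by
    rw [balancedResidueAt, balancedResidue, residueDensity]
    ring
  simp only [h1]
  split_ifs with h
  · exact prod_eq_one fun p hp => if_pos (h p hp)
  · unfold AllResidues at h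
    push Not at h
    obtain ⟨p, hp, hne⟩ := h
    exact prod_eq_zero hp (if_neg hne)

open Classical in
lemma abs_card_filter_sub_le {P : Finset Nat.Primes} {E : ℝ} (hE0 : 0 ≤ E) (a b : ℕ)
    (hE : ∀ Q ⊆ P, Q.Nonempty → |∑ t ∈ Ico a b, residueProd Q t| ≤ E) :
    |(#{t ∈ Ico a b | AllResidues P t} : ℝ) - (b - a : ℕ) * ∏ p ∈ P, residueDensity p| ≤
      2 ^ #P * E := by
  set D : Finset Nat.Primes → ℝ := fun Q => ∏ p ∈ P \ Q, residueDensity p with hD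
  have h1 : (#{t ∈ Ico a b | AllResidues P t} : ℝ) =
      ∑ Q ∈ P.powerset, D Q * ∑ t ∈ Ico a b, residueProd Q t := by
    rw [card_filter]
    push_cast
    simp only [← prod_density_add_eq_ite, prod_add, mul_sum]
    rw [sum_comm]
    refine sum_congr rfl fun Q _ => sum_congr rfl fun t _ => ?_
    rw [mul_comm]
    rfl
  have h2 : (#{t ∈ Ico a b | AllResidues P t} : ℝ) - (b - a : ℕ) * ∏ p ∈ P, residueDensity p =
      ∑ Q ∈ P.powerset.erase ∅, D Q * ∑ t ∈ Ico a b, residueProd Q t := by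
    rw [h1, ← add_sum_erase _ _ (empty_mem_powerset P)]
    simp [hD, residueProd]
    ring
  rw [h2]
  calc _ ≤ ∑ Q ∈ P.powerset.erase ∅, |D Q * ∑ t ∈ Ico a b, residueProd Q t| :=
        abs_sum_le_sum_abs _ _
    _ ≤ ∑ Q ∈ P.powerset.erase ∅, E := by
        refine sum_le_sum fun Q hQ => ?_
        rw [mem_erase, mem_powerset] at hQ
        rw [abs_mul, abs_of_nonneg (prod_nonneg fun p _ => residueDensity_nonneg p)]
        refine (mul_le_of_le_one_left (abs_nonneg _) ?_).trans
          (hE Q hQ.2 (nonempty_iff_ne_empty.2 hQ.1))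
        exact prod_le_one (fun p _ => residueDensity_nonneg p)
          fun p _ => residueDensity_le_one p.2.one_le
    _ ≤ ∑ Q ∈ P.powerset, E := sum_le_sum_of_subset_of_nonneg (erase_subset _ _) fun _ _ _ => hE0
    _ = _ := by simp

lemma legendre_eq_quadraticChar (p : Nat.Primes) (n : ℕ) :
    legendre p n = quadraticChar (ZMod p) n := by
  rw [legendre, dif_pos p.2, legendreSym]
  push_cast
  rfl

lemma isPseudosquare_iff {x : ℝ} {t : ℕ} :
    IsPseudosquare x (8 * t + 1) ↔ ¬ IsSquare (8 * t + 1) ∧ AllResidues (oddPrimes x) t := by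
  have h1 : (∀ p : ℕ, p.Prime → p ≠ 2 → (p : ℝ) ≤ x → legendre p ((8 * t + 1 : ℕ) : ℤ) = 1) ↔
      AllResidues (oddPrimes x) t := by
    constructor
    · intro h p hp
      have h2 := h p p.2 (mem_oddPrimes.1 hp).2 (mem_oddPrimes.1 hp).1
      rw [legendre_eq_quadraticChar] at h2
      exact_mod_cast h2
    · intro h p hp hp2 hpx
      have h2 := h ⟨p, hp⟩ (mem_oddPrimes.2 ⟨hpx, hp2⟩)
      have h3 := legendre_eq_quadraticChar ⟨p, hp⟩ (8 * t + 1)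
      push_cast at h3 h2 ⊢
      rw [h3]
      exact h2
  rw [IsPseudosquare, h1]
  have h4 : (8 * t + 1) % 8 = 1 := by omega
  have h5 : 0 < 8 * t + 1 := by omega
  tauto

lemma floor_le_iff {A : ℝ} (hA : 0 ≤ A) (t : ℕ) :
    ⌊(A + 7) / 8⌋₊ ≤ t ↔ A < ((8 * t + 1 : ℕ) : ℝ) := by
  rw [← Nat.lt_succ_iff, Nat.floor_lt (by positivity), div_lt_iff₀ (by norm_num)]
  push_cast
  constructor <;> intro h <;> linarith

lemma mem_Ico_floor_iff {A N : ℝ} (hA : 0 ≤ A) (hN : 0 ≤ N) (t : ℕ) :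
    t ∈ Ico ⌊(A + 7) / 8⌋₊ ⌊(A + N + 7) / 8⌋₊ ↔
      A < ((8 * t + 1 : ℕ) : ℝ) ∧ ((8 * t + 1 : ℕ) : ℝ) ≤ A + N := by
  rw [mem_Ico, ← not_le (a := ⌊(A + N + 7) / 8⌋₊), floor_le_iff hA, floor_le_iff (by positivity),
    not_lt]

open Classical in
lemma pseudosquaresIn_eq {x A N : ℝ} (hA : 0 ≤ A) (hN : 0 ≤ N) :
    pseudosquaresIn x A N = #{t ∈ {t ∈ Ico ⌊(A + 7) / 8⌋₊ ⌊(A + N + 7) / 8⌋₊ |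
      AllResidues (oddPrimes x) t} | ¬ IsSquare (8 * t + 1)} := by
  have h1 : {n : ℕ | IsPseudosquare x n ∧ A < (n : ℝ) ∧ (n : ℝ) ≤ A + N} =
      (({t ∈ {t ∈ Ico ⌊(A + 7) / 8⌋₊ ⌊(A + N + 7) / 8⌋₊ |
        AllResidues (oddPrimes x) t} | ¬ IsSquare (8 * t + 1)}.image fun t => 8 * t + 1 :
          Finset ℕ) : Set ℕ) := by
    ext n
    simp only [Set.mem_ofPred_eq, coe_image, Set.mem_image, mem_coe, mem_filter,
      mem_Ico_floor_iff hA hN]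
    constructor
    · rintro ⟨hn, hAn, hnN⟩
      obtain ⟨t, rfl⟩ : ∃ t, n = 8 * t + 1 := ⟨n / 8, by have := hn.2.2.1; omega⟩
      rw [isPseudosquare_iff] at hn
      exact ⟨t, ⟨⟨⟨hAn, hnN⟩, hn.2⟩, hn.1⟩, rfl⟩
    · rintro ⟨t, ⟨⟨⟨hAn, hnN⟩, hres⟩, hsq⟩, rfl⟩
      exact ⟨isPseudosquare_iff.2 ⟨hsq, hres⟩, hAn, hnN⟩
  rw [pseudosquaresIn, h1, Set.ncard_coe_finset,
    card_image_of_injective _ fun s t h => by simpa using h]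

open Classical in
lemma card_filter_isSquare_le {A N : ℝ} (hA : 0 ≤ A) (hN : 0 ≤ N) (S : Finset ℕ)
    (hS : S ⊆ Ico ⌊(A + 7) / 8⌋₊ ⌊(A + N + 7) / 8⌋₊) :
    (#{t ∈ S | IsSquare (8 * t + 1)} : ℝ) ≤ √N + 1 := by
  have h1 : #{t ∈ S | IsSquare (8 * t + 1)} ≤ #(Ioc ⌊√A⌋₊ ⌊√(A + N)⌋₊) := by
    refine card_le_card_of_injOn (fun t => Nat.sqrt (8 * t + 1)) ?_ ?_
    · intro t ht
      simp only [coe_filter, Set.mem_ofPred_eq] at ht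
      obtain ⟨htS, r, hr⟩ := ht
      obtain ⟨h2, h3⟩ := (mem_Ico_floor_iff hA hN t).1 (hS htS)
      rw [hr] at h2 h3
      push_cast at h2 h3
      simp only [hr, Nat.sqrt_eq, coe_Ioc, Set.mem_Ioc]
      rw [Nat.floor_lt (Real.sqrt_nonneg _), Nat.le_floor_iff (Real.sqrt_nonneg _),
        Real.sqrt_lt hA (Nat.cast_nonneg _), Real.le_sqrt (by positivity)]
      · exact ⟨by nlinarith, by nlinarith⟩
      · positivity
    · intro s hs t ht hst
      simp only [coe_filter, Set.mem_ofPred_eq] at hs ht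
      obtain ⟨-, r, hr⟩ := hs
      obtain ⟨-, r', hr'⟩ := ht
      simp only [hr, hr', Nat.sqrt_eq] at hst
      rw [hst] at hr
      omega
  rw [Nat.card_Ioc] at h1
  have h2 : √(A + N) ≤ √A + √N := by
    rw [Real.sqrt_le_left (by positivity)]
    nlinarith [Real.sq_sqrt hA, Real.sq_sqrt hN,
      mul_nonneg (Real.sqrt_nonneg A) (Real.sqrt_nonneg N)]
  have h3 := Nat.floor_le (Real.sqrt_nonneg (A + N))
  have h4 := Nat.lt_floor_add_one √A
  have h5 : ⌊√A⌋₊ ≤ ⌊√(A + N)⌋₊ := Nat.floor_mono (Real.sqrt_le_sqrt (by linarith))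
  have h6 : (#{t ∈ S | IsSquare (8 * t + 1)} : ℝ) ≤ ⌊√(A + N)⌋₊ - ⌊√A⌋₊ := by
    rw [← Nat.cast_sub h5]
    exact_mod_cast h1
  linarith

lemma abs_floor_sub_sub_le {A N : ℝ} (hA : 0 ≤ A) (hN : 0 ≤ N) :
    |((⌊(A + N + 7) / 8⌋₊ - ⌊(A + 7) / 8⌋₊ : ℕ) : ℝ) - N / 8| ≤ 1 := by
  have h5 : ⌊(A + 7) / 8⌋₊ ≤ ⌊(A + N + 7) / 8⌋₊ := Nat.floor_mono (by linarith)
  rw [Nat.cast_sub h5, abs_le]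
  have h1 := Nat.floor_le (show 0 ≤ (A + 7) / 8 by positivity)
  have h2 := Nat.lt_floor_add_one ((A + 7) / 8)
  have h3 := Nat.floor_le (show 0 ≤ (A + N + 7) / 8 by positivity)
  have h4 := Nat.lt_floor_add_one ((A + N + 7) / 8)
  constructor <;> linarith

lemma abs_pseudosquaresIn_sub_le {x A N E β : ℝ} (hA : 0 ≤ A) (hN : 0 ≤ N) (hβ : 0 ≤ β)
    (hE0 : 0 ≤ E)
    (hE : ∀ Q ⊆ oddPrimes x, Q.Nonempty → ∀ a b : ℕ,
      |∑ t ∈ Ico a b, residueProd Q t| ≤ E + (b - a : ℕ) * β) :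
    |(pseudosquaresIn x A N : ℝ) - N / 8 * ∏ p ∈ oddPrimes x, residueDensity p| ≤
      √N + 2 + 2 ^ #(oddPrimes x) * (E + (N / 8 + 1) * β) := by
  classical
  set D := ∏ p ∈ oddPrimes x, residueDensity p with hD
  have hD0 : 0 ≤ D := prod_nonneg fun p _ => residueDensity_nonneg p
  have hD1 : D ≤ 1 := prod_le_one (fun p _ => residueDensity_nonneg p)
    fun p _ => residueDensity_le_one p.2.one_le
  set a := ⌊(A + 7) / 8⌋₊
  set b := ⌊(A + N + 7) / 8⌋₊
  set S := {t ∈ Ico a b | AllResidues (oddPrimes x) t} with hS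
  have h1 := abs_card_filter_sub_le (P := oddPrimes x) (E := E + (b - a : ℕ) * β)
    (by positivity) a b fun Q hQ hne => hE Q hQ hne a b
  have h2 : |((b - a : ℕ) : ℝ) - N / 8| ≤ 1 := abs_floor_sub_sub_le hA hN
  have h3 := card_filter_isSquare_le hA hN S (filter_subset _ _)
  have h4 : (#{t ∈ S | IsSquare (8 * t + 1)} : ℝ) + pseudosquaresIn x A N = #S := by
    rw [pseudosquaresIn_eq hA hN]
    exact_mod_cast card_filter_add_card_filter_not _
  have h5 : (0 : ℝ) ≤ #{t ∈ S | IsSquare (8 * t + 1)} := Nat.cast_nonneg _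
  have h6 : 2 ^ #(oddPrimes x) * (E + ((b - a : ℕ) : ℝ) * β) ≤
      2 ^ #(oddPrimes x) * (E + (N / 8 + 1) * β) := by
    gcongr
    linarith [(abs_le.1 h2).2]
  have h7 : |((b - a : ℕ) : ℝ) * D - N / 8 * D| ≤ 1 := by
    rw [← sub_mul, abs_mul, abs_of_nonneg hD0]
    exact mul_le_one₀ h2 hD0 hD1
  rw [← hS, ← hD] at h1
  rw [abs_le] at h1 h7 ⊢
  constructor <;> linarith

lemma inv_three_pow_le_prod_residueDensity (x : ℝ) :
    ((3 : ℝ) ^ #(oddPrimes x))⁻¹ ≤ ∏ p ∈ oddPrimes x, residueDensity p := by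
  rw [← inv_pow, ← prod_const]
  refine prod_le_prod (fun _ _ => by norm_num) fun p hp => ?_
  have := one_third_le_residueDensity (three_le_of_mem_oddPrimes hp)
  norm_num at this ⊢
  exact this

end Counting

section Asymptotics

open Finset

open Filter in
lemma eventually_growth (C : ℝ) : ∀ᶠ x : ℝ in atTop,
    1 ≤ x ∧ C ≤ √x ∧ 10 ≤ Real.log (Real.log x) ∧
    160 * Real.log (Real.log x) ≤ Real.log x ∧
    128 * Real.log (Real.log x) ≤ Real.exp (0.3 * Real.log (Real.log x)) ∧
    58 ^ 4 * Real.log x ^ 3 ≤ √x := by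
  have hlog := Real.tendsto_log_atTop
  have hloglog := hlog.comp hlog
  have h1 : ∀ᶠ u : ℝ in atTop, 160 * Real.log u ≤ u := by
    have := (Real.isLittleO_log_id_atTop).bound (show (0 : ℝ) < 1 / 160 by norm_num)
    filter_upwards [this, eventually_ge_atTop 1] with u hu hu1
    rw [Real.norm_of_nonneg (Real.log_nonneg hu1), id, Real.norm_of_nonneg (by linarith)] at hu
    linarith
  have h2 : ∀ᶠ u : ℝ in atTop, 128 * u ≤ Real.exp (0.3 * u) := by
    have h3 := (isLittleO_pow_exp_pos_mul_atTop 1 (show (0 : ℝ) < 0.3 by norm_num)).bound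
      (show (0 : ℝ) < 1 / 128 by norm_num)
    filter_upwards [h3, eventually_ge_atTop 0] with u hu hu0
    rw [pow_one, Real.norm_of_nonneg hu0, Real.norm_of_nonneg (Real.exp_pos _).le] at hu
    linarith
  have h4 : ∀ᶠ x : ℝ in atTop, 58 ^ 4 * Real.log x ^ 3 ≤ √x := by
    have := (Real.isLittleO_pow_log_id_atTop (n := 6)).bound
      (show (0 : ℝ) < 1 / 58 ^ 8 by norm_num)
    filter_upwards [this, eventually_ge_atTop 1] with x hx hx1
    have hl := Real.log_nonneg hx1
    rw [Real.norm_of_nonneg (by positivity), id, Real.norm_of_nonneg (by linarith)] at hx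
    refine Real.le_sqrt_of_sq_le ?_
    calc (58 ^ 4 * Real.log x ^ 3) ^ 2 = 58 ^ 8 * Real.log x ^ 6 := by ring
      _ ≤ x := by linarith
  filter_upwards [eventually_ge_atTop 1, Real.tendsto_sqrt_atTop.eventually_ge_atTop C,
    hloglog.eventually_ge_atTop 10, hlog.eventually h1, hloglog.eventually h2, h4]
    with x a1 a2 a3 a4 a5 a6
  exact ⟨a1, a2, a3, a4, a5, a6⟩

lemma card_oddPrimes_le_primeCounting (x : ℝ) : #(oddPrimes x) ≤ Nat.primeCounting ⌊x⌋₊ := by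
  rw [Nat.primeCounting, Nat.primeCounting', Nat.count_eq_card_filter_range]
  refine card_le_card_of_injOn (fun p : Nat.Primes => (p : ℕ)) (fun p hp => ?_)
    Nat.Primes.coe_nat_injective.injOn
  have h1 := (mem_oddPrimes.1 hp).1
  rw [coe_filter]
  exact ⟨mem_range.2 (Nat.lt_succ_of_le ((Nat.le_floor_iff' p.2.ne_zero).2 h1)), p.2⟩

lemma card_oddPrimes_le {x : ℝ} (hx : 0 ≤ x) : (#(oddPrimes x) : ℝ) ≤ x := by
  have h1 : #(oddPrimes x) ≤ #(Ioc 0 ⌊x⌋₊) := by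
    refine card_le_card_of_injOn (fun p : Nat.Primes => (p : ℕ)) (fun p hp => ?_)
      Nat.Primes.coe_nat_injective.injOn
    have h1 := (mem_oddPrimes.1 hp).1
    exact mem_Ioc.2 ⟨p.2.pos, (Nat.le_floor_iff' p.2.ne_zero).2 h1⟩
  rw [Nat.card_Ioc] at h1
  exact le_trans (by exact_mod_cast h1) (Nat.floor_le hx)

lemma log_Mx (x : ℝ) : Real.log (Mx x) = Chebyshev.theta x := by
  rw [Chebyshev.theta_eq_log_primorial, Mx, primesUpTo, primorial, Nat.range_succ_eq_Iic]

lemma Mx_pos (x : ℝ) : 0 < Mx x :=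
  prod_pos fun _ hp => (mem_filter.1 hp).2.pos

set_option maxHeartbeats 1600000 in
/-- The choice of the number of blocks and of their size. -/
lemma eventually_exists_parameters {δ : ℝ} (hδ : 0 < δ) : ∀ᶠ x : ℝ in Filter.atTop,
    1 ≤ x ∧ 1 ≤ Real.exp (3 * x / Real.log (Real.log x)) ∧
    Real.exp (3 * x / Real.log (Real.log x)) ≤ Mx x ∧
    72 * 6 ^ #(oddPrimes x) ≤ δ * √(Real.exp (3 * x / Real.log (Real.log x))) ∧
    ∃ (k w : ℕ) (y : ℝ), 0 < k ∧ 1 ≤ y ∧ (29 * 2 ^ k : ℝ) ^ 4 ≤ w ∧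
      (4 : ℝ) ^ ⌊x⌋₊ ≤ (y / x) ^ k ∧
      48 * 6 ^ #(oddPrimes x) * (k * x * y ^ 2) ≤ δ * Real.exp (3 * x / Real.log (Real.log x)) ∧
      27 * 6 ^ #(oddPrimes x) * (y / (x * 4 ^ w)) ^ (-(1 / (4 * 2 ^ k)) : ℝ) ≤ δ := by
  filter_upwards [eventually_growth (100 / δ)] with x ⟨hx1, hδs, hℓ10, h160, h128, h58⟩
  set L := Real.log x with hL
  set ℓ := Real.log L with hℓ
  set s := √x with hs
  have hx0 : 0 < x := by linarith
  have hs0 : 0 < s := Real.sqrt_pos.2 hx0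
  have hss : s * s = x := Real.mul_self_sqrt hx0.le
  have hL1600 : 1600 ≤ L := by linarith
  have hL0 : 0 < L := by linarith
  have hℓ0 : 0 < ℓ := by linarith
  have hexpℓ : Real.exp ℓ = L := Real.exp_log hL0
  have hexpL : Real.exp L = x := Real.exp_log hx0
  have hLs : 58 ^ 4 * L ≤ s := by
    have : L ≤ L ^ 3 := by nlinarith [mul_pos hL0 hL0]
    nlinarith
  have hL2s : 58 ^ 4 * L ^ 2 ≤ s := by
    have : L ^ 2 ≤ L ^ 3 := by nlinarith [mul_pos hL0 hL0]
    nlinarith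
  set v := x / L with hv
  set u := x / ℓ with hu
  have hvL : v * L = x := div_mul_cancel₀ _ hL0.ne'
  have huℓ : u * ℓ = x := div_mul_cancel₀ _ hℓ0.ne'
  have hu0 : 0 < u := div_pos hx0 hℓ0
  have hv0 : 0 < v := div_pos hx0 hL0
  have hsv : 100000 * s ≤ v := by
    rw [hv, le_div_iff₀ hL0]
    nlinarith
  have hvu : 160 * v ≤ u := by
    rw [hu, le_div_iff₀ hℓ0]
    nlinarith
  have hlog2 : Real.log 2 < 0.7 := by linarith [Real.log_two_lt_d9]
  have hlog4 : Real.log 4 < 1.4 := by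
    rw [show (4 : ℝ) = 2 ^ 2 by norm_num, Real.log_pow]
    push_cast
    linarith [Real.log_two_lt_d9]
  have h3u : 3 * x / ℓ = 3 * u := by rw [hu]; ring
  have hπ : (#(oddPrimes x) : ℝ) ≤ 4 * v := by
    have h1 : (#(oddPrimes x) : ℝ) ≤ Nat.primeCounting ⌊x⌋₊ := by
      exact_mod_cast card_oddPrimes_le_primeCounting x
    have h2 := Chebyshev.pi_le_log4_mul_div (x := x) (by
      by_contra! h
      have := Real.log_nonpos hx0.le h
      linarith)
    rw [Real.log_sqrt hx0.le, ← hL, ← hs] at h2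
    have h3 : Real.log 4 * x / (L / 2) = 2 * Real.log 4 * v := by rw [hv]; field_simp
    rw [h3] at h2
    nlinarith
  have h6 : (6 : ℝ) ^ #(oddPrimes x) ≤ Real.exp (8 * v) := by
    have h1 : (6 : ℝ) ≤ Real.exp 2 := by
      have h2 := Real.exp_one_gt_d9
      rw [show (2 : ℝ) = 1 + 1 by norm_num, Real.exp_add]
      nlinarith
    calc (6 : ℝ) ^ #(oddPrimes x) ≤ Real.exp 2 ^ #(oddPrimes x) := by gcongr
      _ = Real.exp (#(oddPrimes x) * 2) := (Real.exp_nat_mul _ _).symm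
      _ ≤ Real.exp (8 * v) := Real.exp_le_exp.2 (by linarith)
  have hδexp : 100 ≤ δ * Real.exp s := by
    have h1 : s ≤ Real.exp s := by linarith [Real.add_one_le_exp s]
    rw [div_le_iff₀ hδ] at hδs
    nlinarith
  set k := ⌈ℓ⌉₊ with hk
  set w := ⌈s⌉₊ with hw
  have hkℓ : ℓ ≤ k := Nat.le_ceil ℓ
  have hkℓ' : (k : ℝ) < ℓ + 1 := Nat.ceil_lt_add_one hℓ0.le
  have hws : s ≤ w := Nat.le_ceil s
  have hws' : (w : ℝ) < s + 1 := Nat.ceil_lt_add_one hs0.le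
  have hk2 : (2 : ℝ) ^ k ≤ 2 * Real.exp (0.7 * ℓ) := by
    have h1 : (2 : ℝ) ^ k = Real.exp (k * Real.log 2) := by
      rw [Real.exp_nat_mul, Real.exp_log (by norm_num)]
    have h2 : (2 : ℝ) * Real.exp (0.7 * ℓ) = Real.exp (Real.log 2 + 0.7 * ℓ) := by
      rw [Real.exp_add, Real.exp_log (by norm_num)]
    rw [h1, h2, Real.exp_le_exp]
    have h3 := mul_le_mul_of_nonneg_right hkℓ'.le
      (Real.log_pos (show (1 : ℝ) < 2 by norm_num)).le
    have h4 := mul_le_mul_of_nonneg_left hlog2.le hℓ0.le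
    linarith
  refine ⟨hx1, Real.one_le_exp (by positivity), ?_, ?_, k, w, Real.exp (1.45 * u), ?_, ?_, ?_, ?_,
    ?_, ?_⟩
  · have hM : (0 : ℝ) < Mx x := by exact_mod_cast Mx_pos x
    rw [← Real.le_log_iff_exp_le hM, log_Mx, h3u]
    refine le_trans ?_ (Chebyshev.theta_ge' hx1)
    have h1 : Real.log (x + 2) ≤ L + 2 := by
      have h2 : x + 2 ≤ Real.exp 2 * x := by
        have := Real.add_one_le_exp (2 : ℝ)
        nlinarith
      calc Real.log (x + 2) ≤ Real.log (Real.exp 2 * x) := Real.log_le_log (by linarith) h2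
        _ = L + 2 := by rw [Real.log_mul (Real.exp_pos _).ne' hx0.ne', Real.log_exp]; ring
    have h3 : 10 * u ≤ x := by nlinarith
    have h4 : 2 * s * L ≤ 0.1 * x := by nlinarith
    have h5 : L ≤ 0.01 * x := by nlinarith
    have h6 := Real.log_two_gt_d9
    nlinarith
  · rw [h3u, ← Real.exp_half]
    calc 72 * (6 : ℝ) ^ #(oddPrimes x) ≤ (δ * Real.exp s) * Real.exp (8 * v) := by
          gcongr
          linarith
      _ = δ * Real.exp (s + 8 * v) := by rw [Real.exp_add]; ring
      _ ≤ δ * Real.exp (3 * u / 2) := by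
          gcongr
          linarith
  · exact Nat.ceil_pos.2 hℓ0
  · exact Real.one_le_exp (by positivity)
  · calc (29 * 2 ^ k : ℝ) ^ 4 ≤ (29 * (2 * Real.exp (0.7 * ℓ))) ^ 4 := by gcongr
      _ = 58 ^ 4 * Real.exp (0.7 * ℓ) ^ 4 := by ring
      _ ≤ 58 ^ 4 * L ^ 3 := by
          gcongr
          rw [← hexpℓ, ← Real.exp_nat_mul, ← Real.exp_nat_mul, Real.exp_le_exp]
          push_cast
          linarith
      _ ≤ w := h58.trans hws
  · have h1 : (4 : ℝ) ^ ⌊x⌋₊ = Real.exp (⌊x⌋₊ * Real.log 4) := by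
      rw [Real.exp_nat_mul, Real.exp_log (by norm_num)]
    have h2 : (Real.exp (1.45 * u) / x) ^ k = Real.exp (k * (1.45 * u - L)) := by
      rw [Real.exp_nat_mul, Real.exp_sub, hexpL]
    rw [h1, h2, Real.exp_le_exp]
    have h3 := Nat.floor_le hx0.le
    have h4 : 1.4 * u ≤ 1.45 * u - L := by linarith
    have h5 : (0 : ℝ) ≤ k := Nat.cast_nonneg _
    have h6 : (⌊x⌋₊ : ℝ) * Real.log 4 ≤ x * 1.4 :=
      mul_le_mul h3 hlog4.le (Real.log_nonneg (by norm_num)) hx0.le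
    have h7 : ℓ * (1.4 * u) ≤ k * (1.45 * u - L) := mul_le_mul hkℓ h4 (by positivity) h5
    linarith
  · have h1 : (k : ℝ) ≤ x := by nlinarith
    have h2 : Real.exp (1.45 * u) ^ 2 = Real.exp (2.9 * u) := by
      rw [← Real.exp_nat_mul]
      congr 1
      push_cast
      ring
    rw [h2, h3u]
    calc 48 * (6 : ℝ) ^ #(oddPrimes x) * (k * x * Real.exp (2.9 * u))
        ≤ (δ * Real.exp s) * Real.exp (8 * v) * (Real.exp L * Real.exp L * Real.exp (2.9 * u)) := by
          rw [hexpL]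
          gcongr
          linarith
      _ = δ * Real.exp (s + 8 * v + 2 * L + 2.9 * u) := by
          simp only [two_mul, Real.exp_add]
          ring
      _ ≤ δ * Real.exp (3 * u) := by
          gcongr
          linarith
  · have h1 : Real.exp (1.45 * u) / (x * 4 ^ w) = Real.exp (1.45 * u - L - w * Real.log 4) := by
      rw [Real.exp_sub, Real.exp_sub, hexpL, Real.exp_nat_mul, Real.exp_log (by norm_num),
        div_div]
    have h2 : u ≤ 1.45 * u - L - w * Real.log 4 := by
      have h3 : (w : ℝ) * Real.log 4 ≤ (s + 1) * 1.4 :=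
        mul_le_mul hws'.le hlog4.le (Real.log_nonneg (by norm_num)) (by linarith)
      linarith
    have h4 : 16 * v ≤ u * (1 / (4 * 2 ^ k)) := by
      rw [mul_one_div, le_div_iff₀ (by positivity)]
      have h5 : Real.exp (0.3 * ℓ) * Real.exp (0.7 * ℓ) = L := by
        rw [← Real.exp_add, ← hexpℓ]
        congr 1
        ring
      have h6 : 128 * ℓ * Real.exp (0.7 * ℓ) ≤ L := by
        rw [← h5]
        gcongr
      have h7 : v * (128 * Real.exp (0.7 * ℓ)) * ℓ ≤ u * ℓ := by
        rw [huℓ, ← hvL]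
        nlinarith
      have h8 := le_of_mul_le_mul_right h7 hℓ0
      nlinarith
    rw [h1, ← Real.exp_mul]
    calc 27 * (6 : ℝ) ^ #(oddPrimes x) * Real.exp ((1.45 * u - L - w * Real.log 4) *
          -(1 / (4 * 2 ^ k))) ≤ (δ * Real.exp s) * Real.exp (8 * v) * Real.exp (-(16 * v)) := by
          have h9 : u * (1 / (4 * 2 ^ k)) ≤
              (1.45 * u - L - w * Real.log 4) * (1 / (4 * 2 ^ k)) := by
            gcongr
          gcongr
          · linarith
          · linarith
      _ = δ * Real.exp (s + 8 * v + -(16 * v)) := by rw [Real.exp_add, Real.exp_add]; ring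
      _ ≤ δ * 1 := by
          gcongr
          rw [Real.exp_le_one_iff]
          linarith
      _ = δ := mul_one δ

lemma eventually_abs_pseudosquaresIn_sub_le {δ : ℝ} (hδ : 0 < δ) : ∀ᶠ x : ℝ in Filter.atTop,
    Real.exp (3 * x / Real.log (Real.log x)) ≤ Mx x ∧ ∀ A : ℝ, 0 ≤ A → ∀ N : ℝ,
      Real.exp (3 * x / Real.log (Real.log x)) ≤ N →
      |(pseudosquaresIn x A N : ℝ) - N / 8 * ∏ p ∈ oddPrimes x, residueDensity p| ≤
        δ * (N / 8 * ∏ p ∈ oddPrimes x, residueDensity p) := by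
  filter_upwards [eventually_exists_parameters hδ] with x
    ⟨hx1, hexp1, hM, hsqrt, k, w, y, hk, hy, hw, hfour, hmain, hβ⟩
  refine ⟨hM, fun A hA N hN => ?_⟩
  set X := Real.exp (3 * x / Real.log (Real.log x))
  set D := ∏ p ∈ oddPrimes x, residueDensity p
  set β := (y / (x * 4 ^ w)) ^ (-(1 / (4 * 2 ^ k)) : ℝ)
  set r := #(oddPrimes x) with hr
  have hx0 : 0 < x := by linarith
  have hy0 : 0 < y := by linarith
  have hN1 : 1 ≤ N := hexp1.trans hN
  have hβ0 : 0 ≤ β := by positivity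
  have h1 := abs_pseudosquaresIn_sub_le (x := x) (E := 2 * (k * x * y ^ 2)) hA
    (zero_le_one.trans hN1) hβ0 (by positivity) ?_
  · refine h1.trans ?_
    have hD : ((3 : ℝ) ^ r)⁻¹ ≤ D := inv_three_pow_le_prod_residueDensity x
    have hs1 : 1 ≤ √N := Real.one_le_sqrt.2 hN1
    have hss : √N * √N = N := Real.mul_self_sqrt (by linarith)
    have h36 : (3 : ℝ) ^ r ≤ 6 ^ r := by gcongr; norm_num
    have h26 : (2 : ℝ) ^ r * 3 ^ r = 6 ^ r := by rw [← mul_pow]; norm_num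
    have ha : 72 * 6 ^ r * √N ≤ δ * N := by
      have : 72 * 6 ^ r ≤ δ * √N := hsqrt.trans (by gcongr)
      calc 72 * 6 ^ r * √N ≤ δ * √N * √N := by gcongr
        _ = δ * N := by rw [mul_assoc, hss]
    have hb : 48 * 6 ^ r * (k * x * y ^ 2) ≤ δ * N := hmain.trans (by gcongr)
    have hc : 27 * 6 ^ r * β * N ≤ δ * N := by gcongr
    have hkey : 8 * 3 ^ r * (√N + 2 + 2 ^ r * (2 * (k * x * y ^ 2) + (N / 8 + 1) * β)) ≤ δ * N := by
      calc 8 * 3 ^ r * (√N + 2 + 2 ^ r * (2 * (k * x * y ^ 2) + (N / 8 + 1) * β))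
          = 8 * 3 ^ r * (√N + 2) + 16 * 6 ^ r * (k * x * y ^ 2) + 6 ^ r * β * (N + 8) := by
            rw [← h26]; ring
        _ ≤ 8 * 6 ^ r * (√N + 2 * √N) + 16 * 6 ^ r * (k * x * y ^ 2) + 6 ^ r * β * (N + 8 * N) := by
            gcongr <;> linarith
        _ ≤ δ * N := by linarith
    calc _ = 8 * 3 ^ r * (√N + 2 + 2 ^ r * (2 * (k * x * y ^ 2) + (N / 8 + 1) * β)) *
          (((3 : ℝ) ^ r)⁻¹ / 8) := by
          rw [← hr]
          field_simp
      _ ≤ δ * N * (D / 8) := by gcongr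
      _ = _ := by ring
  · intro Q hQ hne a b
    refine abs_sum_residueProd_le hne (fun p hp => (mem_oddPrimes.1 (hQ hp)).2)
      (fun p hp => (mem_oddPrimes.1 (hQ hp)).1) ?_ hx1 hy hk hw ?_ a b
    · exact le_trans (by exact_mod_cast card_le_card hQ) (card_oddPrimes_le hx0.le)
    · refine le_trans ?_ hfour
      exact_mod_cast primesProd_le_four_pow fun p hp =>
        (Nat.le_floor_iff' p.2.ne_zero).2 (mem_oddPrimes.1 (hQ hp)).1

end Asymptotics

/-- **Theorem 1 (equidistribution of pseudosquares).**
For every `ε > 0` there is `x₀` such that for all `x ≥ x₀`, all `A ≥ 0` and all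
`N ≥ exp(3x / log log x)`,
`#(S_x ∩ (A, A+N]) = (1 + O(ε)) · (N / M(x)) · #(S_x ∩ (0, M(x)])`. -/
theorem pseudosquares_equidistributed :
    ∀ ε : ℝ, 0 < ε → ∃ x₀ : ℝ, ∀ x : ℝ, x₀ ≤ x → ∀ A : ℝ, 0 ≤ A →
      ∀ N : ℝ, Real.exp (3 * x / Real.log (Real.log x)) ≤ N →
        |(pseudosquaresIn x A N : ℝ) -
            N / (Mx x : ℝ) * (pseudosquaresIn x 0 (Mx x) : ℝ)| ≤
          ε * (N / (Mx x : ℝ) * (pseudosquaresIn x 0 (Mx x) : ℝ)) := by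
  intro ε hε
  set δ := min (ε / 4) (1 / 2) with hδ
  have hδ0 : 0 < δ := by positivity
  obtain ⟨x₀, hx₀⟩ := Filter.eventually_atTop.1 (eventually_abs_pseudosquaresIn_sub_le hδ0)
  refine ⟨x₀, fun x hx A hA N hN => ?_⟩
  obtain ⟨hM, hcount⟩ := hx₀ x hx
  have hM0 : (0 : ℝ) < Mx x := by exact_mod_cast Mx_pos x
  have hN0 : 0 < N := (Real.exp_pos _).trans_le hN
  have h1 := hcount A hA N hN
  have h2 := hcount 0 le_rfl (Mx x) hM
  set D := ∏ p ∈ oddPrimes x, residueDensity p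
  have hD : 0 ≤ N / 8 * D :=
    mul_nonneg (by positivity) (Finset.prod_nonneg fun p _ => residueDensity_nonneg p)
  have h3 : |N / Mx x * pseudosquaresIn x 0 (Mx x) - N / 8 * D| ≤ δ * (N / 8 * D) := by
    calc |N / Mx x * pseudosquaresIn x 0 (Mx x) - N / 8 * D|
        = |N / Mx x * (pseudosquaresIn x 0 (Mx x) - Mx x / 8 * D)| := by
          congr 1
          field_simp
      _ = N / Mx x * |pseudosquaresIn x 0 (Mx x) - Mx x / 8 * D| := by
          rw [abs_mul, abs_of_pos (by positivity)]
      _ ≤ N / Mx x * (δ * (Mx x / 8 * D)) := by gcongr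
      _ = δ * (N / 8 * D) := by field_simp
  have hδε : δ ≤ ε / 4 := min_le_left _ _
  have hδ2 : δ ≤ 1 / 2 := min_le_right _ _
  have h4 : δ * (N / 8 * D) ≤ 1 / 2 * (N / 8 * D) := by gcongr
  have h5 : δ * (N / 8 * D) ≤ ε / 4 * (N / 8 * D) := by gcongr
  rw [abs_le] at h1 h3 ⊢
  have h6 : ε * (1 / 2 * (N / 8 * D)) ≤ ε * (N / Mx x * pseudosquaresIn x 0 (Mx x)) := by
    refine mul_le_mul_of_nonneg_left ?_ hε.le
    linarith
  constructor <;> linarith
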